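/- arXiv:math/0001122 — 2 statements merged into one kernel-verified Lean document; each statement's English description precedes it below -/
import Mathlib

section
/- Let G ⊂ ℂ be a bounded simply connected domain and z₀ ∈ G, and let φ : G → {w : |w| < R₀} be an analytic bijection with φ(z₀) = 0 and φ'(z₀) = 1. Then ∫∫_G |φ'(z)|² dx dy = π R₀², and for every analytic function f on G with f(z₀) = 0, f'(z₀) = 1 and ∫∫_G |f'(z)|² dx dy < ∞ one has the identity ∫∫_G |f'(z)|² dx dy = π R₀² + ∫∫_G |f'(z) − φ'(z)|² dx dy. In particular φ minimizes ∫∫_G |f'|² dx dy among all analytic f on G with f(z₀) = 0 and f'(z₀) = 1. -/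
open MeasureTheory Filter

open scoped Topology

/-- An injective holomorphic function on an open set has a holomorphic inverse. -/
theorem hasDerivAt_invFunOn_of_differentiableOn {U : Set ℂ} {f : ℂ → ℂ}
    (hf : DifferentiableOn ℂ f U) (hU : IsOpen U) (hinj : Set.InjOn f U) {z : ℂ} (hz : z ∈ U) :
    deriv f z ≠ 0 ∧ HasDerivAt (Function.invFunOn f U) (deriv f z)⁻¹ (f z) := by
  set g := Function.invFunOn f U
  have hgf : ∀ w ∈ U, g (f w) = w := fun w hw => hinj.leftInvOn_invFunOn hw
  have hUz : ∀ w ∈ U, ∀ᶠ v in 𝓝 w, v ∈ U := fun w hw => hU.mem_nhds hw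
  have han : ∀ w ∈ U, AnalyticAt ℂ f w := fun w hw => hf.analyticAt (hU.mem_nhds hw)
  have hnc : ∀ w ∈ U, ¬ ∀ᶠ v in 𝓝 w, f v = f w := fun w hw h => by
    have h' : ∀ᶠ v in 𝓝 w, v = w := by
      filter_upwards [h, hUz w hw] with v hv hvU using hinj hvU hw hv
    obtain ⟨v, hv, hne⟩ := ((h'.filter_mono nhdsWithin_le_nhds).and
      (self_mem_nhdsWithin (s := {w}ᶜ))).exists
    exact hne hv
  have hopen : ∀ w ∈ U, 𝓝 (f w) ≤ map f (𝓝 w) := fun w hw =>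
    (han w hw).eventually_constant_or_nhds_le_map_nhds.resolve_left (hnc w hw)
  have hcont : ∀ w ∈ U, ContinuousAt g (f w) := fun w hw => by
    rw [ContinuousAt, hgf w hw]
    refine Tendsto.mono_left (tendsto_map'_iff.2 ?_) (hopen w hw)
    exact tendsto_id.congr' (by filter_upwards [hUz w hw] with v hv using (hgf v hv).symm)
  have hfg : ∀ w ∈ U, ∀ᶠ y in 𝓝 (f w), f (g y) = y := fun w hw =>
    hopen w hw (mem_map.2 (by filter_upwards [hUz w hw] with v hv; simp [hgf v hv]))
  have hderiv : ∀ w ∈ U, deriv f w ≠ 0 → HasDerivAt g (deriv f w)⁻¹ (f w) := fun w hw h => by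
    refine HasDerivAt.of_local_left_inverse (hcont w hw) ?_ h (hfg w hw)
    rw [hgf w hw]
    exact (han w hw).differentiableAt.hasDerivAt
  suffices h : deriv f z ≠ 0 from ⟨h, hderiv z hz h⟩
  have hiso : ∀ᶠ w in 𝓝 z, w ≠ z → deriv f w ≠ 0 := by
    rcases (han z hz).deriv.eventually_eq_zero_or_eventually_ne_zero with h | h
    · have := (han z hz).analyticOrderAt_deriv_add_one
      rw [analyticOrderAt_eq_top.2 h, top_add, eq_comm, analyticOrderAt_eq_top] at this
      exact (hnc z hz (this.mono fun w hw => sub_eq_zero.1 hw)).elim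
    · exact eventually_nhdsWithin_iff.1 h
  have hdiff : ∀ᶠ y in 𝓝[≠] (f z), DifferentiableAt ℂ g y := by
    rw [eventually_nhdsWithin_iff]
    refine hopen z hz (mem_map.2 ?_)
    filter_upwards [hiso, hUz z hz] with w hw hwU hne
    exact (hderiv w hwU (hw fun h => hne (by simp [h]))).differentiableAt
  have hg := (Complex.analyticAt_of_differentiable_on_punctured_nhds_of_continuousAt hdiff
    (hcont z hz)).differentiableAt.hasDerivAt
  have hcomp := (hg.comp z (han z hz).differentiableAt.hasDerivAt).congr_of_eventuallyEq
    (f₁ := id) (by filter_upwards [hUz z hz] with w hw using (hgf w hw).symm)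
  exact right_ne_zero_of_mul_eq_one (hcomp.unique (hasDerivAt_id z))

/-- The integrand of the polar coordinates formula is integrable if the original function is. -/
theorem integrableOn_polarCoord_target {E : Type*} [NormedAddCommGroup E] [NormedSpace ℝ E]
    {f : ℂ → E} (hf : Integrable f) :
    IntegrableOn (fun p => p.1 • f (Complex.polarCoord.symm p)) polarCoord.target := by
  have h1 : Integrable (f ∘ Complex.measurableEquivRealProd.symm) :=
    (Complex.volume_preserving_equiv_real_prod.symm).integrable_comp_emb
      Complex.measurableEquivRealProd.symm.measurableEmbedding |>.2 hf
  have h2 := (integrableOn_image_iff_integrableOn_abs_det_fderiv_smul volume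
    polarCoord.open_target.measurableSet
    (fun p _ => (hasFDerivAt_polarCoord_symm p).hasFDerivWithinAt)
    polarCoord.symm.injOn _).1 h1.integrableOn
  refine h2.congr_fun (fun p hp => ?_) polarCoord.open_target.measurableSet
  simp only [det_fderivPolarCoordSymm, Function.comp_apply,
    Complex.measurableEquivRealProd_symm_polarCoord_symm_apply]
  rw [abs_of_pos hp.1]

/-- The area integral over a disk of an integrable holomorphic function vanishing at the centre
is zero. -/
theorem setIntegral_ball_eq_zero_of_differentiableOn {E : Type*} [NormedAddCommGroup E]
    [NormedSpace ℂ E] [CompleteSpace E] {R : ℝ} {g : ℂ → E}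
    (hg : DifferentiableOn ℂ g (Metric.ball 0 R)) (hint : IntegrableOn g (Metric.ball 0 R))
    (h0 : g 0 = 0) :
    ∫ w in Metric.ball 0 R, g w = 0 := by
  have hI := integrableOn_polarCoord_target (hint.integrable_indicator measurableSet_ball)
  rw [← integral_indicator measurableSet_ball, ← Complex.integral_comp_polarCoord_symm]
  rw [polarCoord_target, Measure.volume_eq_prod] at hI ⊢
  rw [setIntegral_prod _ hI]
  refine setIntegral_eq_zero_of_forall_eq_zero fun r (hr : 0 < r) => ?_
  rw [integral_smul]
  refine smul_eq_zero_of_right _ ?_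
  have hsymm (θ : ℝ) : Complex.polarCoord.symm (r, θ) = circleMap 0 r θ := by
    simp [circleMap, Complex.exp_mul_I]
  simp only [hsymm]
  by_cases hrR : r < R
  · have hmem (θ : ℝ) : circleMap 0 r θ ∈ Metric.ball (0 : ℂ) R := by simp [abs_of_pos hr, hrR]
    simp only [Set.indicator_of_mem (hmem _)]
    have havg : Real.circleAverage g 0 r = 0 := by
      rw [← h0]
      refine DiffContOnCl.circleAverage (hg.mono ?_).diffContOnCl
      refine (Metric.closure_ball_subset_closedBall).trans ?_
      rw [abs_of_pos hr]
      exact Metric.closedBall_subset_ball hrR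
    rw [Real.circleAverage_def, smul_eq_zero_iff_right (by positivity)] at havg
    have hper : Function.Periodic (fun θ => g (circleMap 0 r θ)) (2 * Real.pi) := fun θ => by
      simp [periodic_circleMap 0 r θ]
    have := hper.intervalIntegral_add_eq (-Real.pi) 0
    rw [zero_add, havg, intervalIntegral.integral_of_le (by linarith [Real.pi_pos]),
      integral_Ioc_eq_integral_Ioo] at this
    rwa [show -Real.pi + 2 * Real.pi = Real.pi by ring] at this
  · have hmem (θ : ℝ) : circleMap 0 r θ ∉ Metric.ball (0 : ℂ) R := by
      simpa [abs_of_pos hr] using hrR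
    simp [Set.indicator_of_notMem (hmem _)]

theorem Complex.abs_det_restrictScalars_toSpanSingleton (c : ℂ) :
    |((ContinuousLinearMap.toSpanSingleton ℂ c).restrictScalars ℝ).det| = ‖c‖ ^ 2 := by
  have : ((ContinuousLinearMap.toSpanSingleton ℂ c).restrictScalars ℝ).det = ‖c‖ ^ 2 := by
    rw [← Complex.normSq_eq_norm_sq, ← Algebra.norm_complex_apply, Algebra.norm_apply]
    unfold ContinuousLinearMap.det
    congr 1
    ext
    simp [mul_comm]
  rw [this, abs_of_nonneg (by positivity)]

theorem hasFDerivWithinAt_real_of_differentiableOn {U : Set ℂ} {f : ℂ → ℂ}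
    (hf : DifferentiableOn ℂ f U) (hU : IsOpen U) {z : ℂ} (hz : z ∈ U) :
    HasFDerivWithinAt f ((ContinuousLinearMap.toSpanSingleton ℂ (deriv f z)).restrictScalars ℝ)
      U z :=
  (hf.differentiableAt (hU.mem_nhds hz)).hasDerivAt.hasFDerivAt.hasFDerivWithinAt.restrictScalars ℝ

section AreaIntegral

variable {G : Set ℂ} {φ : ℂ → ℂ} {R : ℝ}

theorem integrableOn_norm_deriv_sq_of_bijOn_ball (hG : IsOpen G) (hφ : DifferentiableOn ℂ φ G)
    (hbij : Set.BijOn φ G (Metric.ball 0 R)) : IntegrableOn (fun z => ‖deriv φ z‖ ^ 2) G := by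
  have h := (integrableOn_image_iff_integrableOn_abs_det_fderiv_smul volume hG.measurableSet
    (fun z hz => hasFDerivWithinAt_real_of_differentiableOn hφ hG hz) hbij.injOn
    (fun _ => (1 : ℝ))).1 (by rw [hbij.image_eq]; exact integrableOn_const measure_ball_lt_top.ne)
  simpa only [Complex.abs_det_restrictScalars_toSpanSingleton, smul_eq_mul, mul_one] using h

theorem setIntegral_norm_deriv_sq_of_bijOn_ball (hG : IsOpen G) (hφ : DifferentiableOn ℂ φ G)
    (hbij : Set.BijOn φ G (Metric.ball 0 R)) (hR : 0 ≤ R) :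
    ∫ z in G, ‖deriv φ z‖ ^ 2 = Real.pi * R ^ 2 := by
  have h := integral_image_eq_integral_abs_det_fderiv_smul volume hG.measurableSet
    (fun z hz => hasFDerivWithinAt_real_of_differentiableOn hφ hG hz) hbij.injOn
    (fun _ => (1 : ℝ))
  rw [hbij.image_eq] at h
  simp only [Complex.abs_det_restrictScalars_toSpanSingleton, smul_eq_mul, mul_one] at h
  rw [← h]
  simp [measureReal_def, Complex.volume_ball, hR, mul_comm]

/-- A square integrable holomorphic function vanishing at the zero of a conformal map onto a disk
is orthogonal in `L²` to the derivative of this map. -/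
theorem setIntegral_mul_conj_deriv_eq_zero (hG : IsOpen G) (hφ : DifferentiableOn ℂ φ G)
    (hbij : Set.BijOn φ G (Metric.ball 0 R)) {z₀ : ℂ} (hz₀ : z₀ ∈ G) (hφ0 : φ z₀ = 0)
    {k : ℂ → ℂ} (hk : DifferentiableOn ℂ k G) (hk0 : k z₀ = 0)
    (hint : IntegrableOn (fun z => k z * starRingEnd ℂ (deriv φ z)) G) :
    ∫ z in G, k z * starRingEnd ℂ (deriv φ z) = 0 := by
  set ψ := Function.invFunOn φ G
  have hψφ : ∀ z ∈ G, ψ (φ z) = z := fun z hz => hbij.injOn.leftInvOn_invFunOn hz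
  have hψ' := fun z hz => hasDerivAt_invFunOn_of_differentiableOn hφ hG hbij.injOn (z := z) hz
  have hψd : DifferentiableOn ℂ ψ (Metric.ball 0 R) := fun w hw => by
    obtain ⟨z, hz, rfl⟩ := hbij.surjOn hw
    exact (hψ' z hz).2.differentiableAt.differentiableWithinAt
  have hmaps : Set.MapsTo ψ (Metric.ball 0 R) G := fun w hw => by
    obtain ⟨z, hz, rfl⟩ := hbij.surjOn hw
    rwa [hψφ z hz]
  have hg : DifferentiableOn ℂ (fun w => k (ψ w) * deriv ψ w) (Metric.ball 0 R) :=
    (hk.comp hψd hmaps).mul (hψd.deriv Metric.isOpen_ball)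
  have hF := fun z hz => hasFDerivWithinAt_real_of_differentiableOn hφ hG (z := z) hz
  have hcongr : Set.EqOn (fun z => k z * starRingEnd ℂ (deriv φ z))
      (fun z => |((ContinuousLinearMap.toSpanSingleton ℂ (deriv φ z)).restrictScalars ℝ).det| •
        (k (ψ (φ z)) * deriv ψ (φ z))) G := fun z hz => by
    have hne := (hψ' z hz).1
    simp only [Complex.abs_det_restrictScalars_toSpanSingleton]
    rw [hψφ z hz, (hψ' z hz).2.deriv, Complex.real_smul, Complex.ofReal_pow, ← Complex.mul_conj']
    field_simp
  have himg := integral_image_eq_integral_abs_det_fderiv_smul volume hG.measurableSet hF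
    hbij.injOn (fun w => k (ψ w) * deriv ψ w)
  rw [setIntegral_congr_fun hG.measurableSet hcongr, ← himg, hbij.image_eq]
  refine setIntegral_ball_eq_zero_of_differentiableOn hg ?_ ?_
  · rw [← hbij.image_eq, integrableOn_image_iff_integrableOn_abs_det_fderiv_smul volume
      hG.measurableSet hF hbij.injOn]
    exact hint.congr_fun hcongr hG.measurableSet
  · have := hψφ z₀ hz₀
    rw [hφ0] at this
    simp [this, hk0]

end AreaIntegral

/-- **Extremal property of the normalized conformal map.**
If `φ` maps the bounded simply connected domain `G` conformally onto the disk of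
radius `R₀`, normalized by `φ z₀ = 0` and `φ' z₀ = 1`, then
`∫∫_G |φ'|² = π R₀²`, and for every analytic `f` on `G` with `f z₀ = 0`,
`f' z₀ = 1` and `∫∫_G |f'|² < ∞` one has
`∫∫_G |f'|² = π R₀² + ∫∫_G |f' - φ'|²`; in particular `φ` minimizes the
Dirichlet integral among all such `f`. -/
theorem conformal_map_minimizes_dirichlet_integral
    (G : Set ℂ) (hGopen : IsOpen G) (hGbdd : Bornology.IsBounded G)
    (hGconn : IsConnected G) (hGsc : SimplyConnectedSpace G)
    (z₀ : ℂ) (hz₀ : z₀ ∈ G) (R₀ : ℝ) (hR₀ : 0 < R₀)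
    (φ : ℂ → ℂ) (hφdiff : DifferentiableOn ℂ φ G)
    (hφbij : Set.BijOn φ G (Metric.ball (0 : ℂ) R₀))
    (hφ0 : φ z₀ = 0) (hφ1 : deriv φ z₀ = 1) :
    (∫ z in G, ‖deriv φ z‖ ^ 2) = Real.pi * R₀ ^ 2 ∧
    ∀ f : ℂ → ℂ, DifferentiableOn ℂ f G → f z₀ = 0 → deriv f z₀ = 1 →
      IntegrableOn (fun z => ‖deriv f z‖ ^ 2) G →
      ((∫ z in G, ‖deriv f z‖ ^ 2) =
          Real.pi * R₀ ^ 2 + ∫ z in G, ‖deriv f z - deriv φ z‖ ^ 2) ∧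
      (∫ z in G, ‖deriv φ z‖ ^ 2) ≤ ∫ z in G, ‖deriv f z‖ ^ 2 := by
  have hφi := integrableOn_norm_deriv_sq_of_bijOn_ball hGopen hφdiff hφbij
  have hφv := setIntegral_norm_deriv_sq_of_bijOn_ball hGopen hφdiff hφbij hR₀.le
  refine ⟨hφv, fun f hf _ hf1 hfi => ?_⟩
  suffices h : (∫ z in G, ‖deriv f z‖ ^ 2) =
      Real.pi * R₀ ^ 2 + ∫ z in G, ‖deriv f z - deriv φ z‖ ^ 2 by
    refine ⟨h, ?_⟩
    rw [h, hφv, le_add_iff_nonneg_right]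
    exact integral_nonneg fun z => by positivity
  have hfL : MemLp (deriv f) 2 (volume.restrict G) :=
    (memLp_two_iff_integrable_sq_norm (measurable_deriv f).aestronglyMeasurable).2 hfi
  have hφL : MemLp (deriv φ) 2 (volume.restrict G) :=
    (memLp_two_iff_integrable_sq_norm (measurable_deriv φ).aestronglyMeasurable).2 hφi
  have hkL := hfL.sub hφL
  have hki : IntegrableOn (fun z => ‖deriv f z - deriv φ z‖ ^ 2) G :=
    (memLp_two_iff_integrable_sq_norm hkL.1).1 hkL
  have hci : IntegrableOn
      (fun z => (deriv f z - deriv φ z) * starRingEnd ℂ (deriv φ z)) G :=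
    hkL.integrable_mul hφL.star
  have horth := setIntegral_mul_conj_deriv_eq_zero hGopen hφdiff hφbij hz₀ hφ0
    ((hf.deriv hGopen).sub (hφdiff.deriv hGopen)) (by simp [hf1, hφ1]) hci
  have hrei : IntegrableOn
      (fun z => ((deriv f z - deriv φ z) * starRingEnd ℂ (deriv φ z)).re) G := hci.re
  have hsum : IntegrableOn (fun z => ‖deriv φ z‖ ^ 2 + ‖deriv f z - deriv φ z‖ ^ 2) G :=
    hφi.add hki
  have hre : ∫ z in G, ((deriv f z - deriv φ z) * starRingEnd ℂ (deriv φ z)).re = 0 := by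
    have := integral_re hci
    simp only [RCLike.re_eq_complex_re] at this
    rw [this]
    exact congrArg Complex.re horth
  have hexp : ∀ z, ‖deriv f z‖ ^ 2 = ‖deriv φ z‖ ^ 2 + ‖deriv f z - deriv φ z‖ ^ 2 +
      2 * ((deriv f z - deriv φ z) * starRingEnd ℂ (deriv φ z)).re := fun z => by
    simp only [← Complex.normSq_eq_norm_sq, Complex.normSq_apply, Complex.mul_re, Complex.sub_re,
      Complex.sub_im, Complex.conj_re, Complex.conj_im]
    ring
  simp only [hexp]
  rw [integral_add hsum (hrei.const_mul 2), integral_add hφi hki, integral_const_mul,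
    hre, hφv, mul_zero, add_zero]
end

section
/- Let G be a Jordan domain, z₀ ∈ G, let (K_n)_{n≥0} be the area orthonormal polynomials of G, and let R₀ be the inner conformal radius of G with respect to z₀ (so there is an analytic bijection φ : G → {w : |w| < R₀} with φ(z₀) = 0 and φ'(z₀) = 1). Then Σ_{k=0}^{∞} |K_k(z₀)|² = 1/(π R₀²). -/
open MeasureTheory Filter

/-- A Jordan domain: a bounded simply connected open subset of `ℂ` whose
boundary is a Jordan curve (the image of an injective continuous map of the
unit circle). -/
def IsJordanDomain (G : Set ℂ) : Prop :=
  IsOpen G ∧ Bornology.IsBounded G ∧ SimplyConnectedSpace G ∧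
    ∃ γ : C(Metric.sphere (0 : ℂ) 1, ℂ),
      Function.Injective γ ∧ Set.range γ = frontier G

/-- The area orthonormal polynomials of `G`: `K n` has exact degree `n`,
positive leading coefficient, and `∫∫_G K_m conj(K_n) = δ_{mn}`. -/
def AreaOrthonormalPolys (G : Set ℂ) (K : ℕ → Polynomial ℂ) : Prop :=
  (∀ n, (K n).natDegree = n) ∧
  (∀ n, ∃ a : ℝ, 0 < a ∧ (K n).leadingCoeff = (a : ℂ)) ∧
  (∀ m n, (∫ z in G, (K m).eval z * (starRingEnd ℂ) ((K n).eval z)) =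
      if m = n then (1 : ℂ) else 0)

section

open Set Metric Topology Polynomial ComplexConjugate

/-- An injective holomorphic function on an open set is a local homeomorphism: its inverse is
differentiable, with the expected derivative. -/
theorem hasDerivAt_leftInvOn_of_injOn {U : Set ℂ} (hU : IsOpen U) {f g : ℂ → ℂ}
    (hf : DifferentiableOn ℂ f U) (hg : LeftInvOn g f U) {z : ℂ} (hz : z ∈ U) :
    f '' U ∈ 𝓝 (f z) ∧ deriv f z ≠ 0 ∧ HasDerivAt g (deriv f z)⁻¹ (f z) := by
  have hinj : InjOn f U := hg.injOn
  have key : ∀ x ∈ U, (𝓝 (f x) ≤ map f (𝓝 x)) ∧ ∀ᶠ y in 𝓝[≠] x, deriv f y ≠ 0 := by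
    intro x hx
    have han : AnalyticAt ℂ f x := hf.analyticAt (hU.mem_nhds hx)
    have hnc : ¬ ∀ᶠ y in 𝓝 x, f y = f x := by
      intro h
      have h2 : ∀ᶠ y in 𝓝 x, y = x := by
        filter_upwards [h, hU.mem_nhds hx] with y hy hyU using hinj hyU hx hy
      have h3 : ∀ᶠ y in 𝓝[≠] x, False := by
        filter_upwards [h2.filter_mono nhdsWithin_le_nhds, self_mem_nhdsWithin] with y hy hy'
        exact hy' hy
      exact (NormedField.nhdsNE_neBot x).ne (by simpa using h3)
    refine ⟨han.eventually_constant_or_nhds_le_map_nhds.resolve_left hnc, ?_⟩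
    refine han.deriv.eventually_eq_zero_or_eventually_ne_zero.resolve_left fun h => hnc ?_
    obtain ⟨r, hr, hball⟩ := Metric.eventually_nhds_iff_ball.1 (h.and (hU.eventually_mem hx))
    filter_upwards [ball_mem_nhds x hr] with y hy
    refine isOpen_ball.is_const_of_deriv_eq_zero (convex_ball x r).isPreconnected
      (hf.mono fun w hw => (hball w hw).2) (fun w hw => (hball w hw).1) hy (mem_ball_self hr)
  have hcont : ∀ x ∈ U, ContinuousAt g (f x) := by
    intro x hx
    rw [ContinuousAt, hg hx]
    refine Tendsto.mono_left ?_ (key x hx).1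
    rw [tendsto_map'_iff]
    refine tendsto_id.congr' ?_
    filter_upwards [hU.mem_nhds hx] with y hy using (hg hy).symm
  have himg : ∀ x ∈ U, f '' U ∈ 𝓝 (f x) := fun x hx =>
    (key x hx).1 (image_mem_map (hU.mem_nhds hx))
  have hreg : ∀ x ∈ U, deriv f x ≠ 0 → HasDerivAt g (deriv f x)⁻¹ (f x) := by
    intro x hx hd
    refine HasDerivAt.of_local_left_inverse (hcont x hx) (by rw [hg hx]; exact
      (hf.differentiableAt (hU.mem_nhds hx)).hasDerivAt) hd ?_
    filter_upwards [himg x hx]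
    rintro _ ⟨y, hy, rfl⟩
    rw [hg hy]
  have hdiff : DifferentiableAt ℂ g (f z) := by
    refine (Complex.analyticAt_of_differentiable_on_punctured_nhds_of_continuousAt ?_
      (hcont z hz)).differentiableAt
    have h1 : Tendsto g (𝓝 (f z)) (𝓝 z) := by
      have := hcont z hz; rwa [ContinuousAt, hg hz] at this
    have h2 := (eventually_nhdsWithin_iff.1 (key z hz).2)
    rw [eventually_nhdsWithin_iff]
    filter_upwards [h1.eventually h2, himg z hz]
    rintro _ h ⟨y, hy, rfl⟩ hne
    rw [hg hy] at h
    exact (hreg y hy (h fun h => hne (by rw [h]; rfl))).differentiableAt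
  have hd : deriv f z ≠ 0 := by
    intro h0
    have h1 : HasDerivAt (g ∘ f) (deriv g (f z) * deriv f z) z :=
      hdiff.hasDerivAt.comp z (hf.differentiableAt (hU.mem_nhds hz)).hasDerivAt
    have h2 : HasDerivAt (g ∘ f) 1 z := (hasDerivAt_id z).congr_of_eventuallyEq (by
      filter_upwards [hU.mem_nhds hz] with y hy using hg hy)
    have := h1.unique h2
    simp [h0] at this
  exact ⟨himg z hz, hd, hreg z hz hd⟩

theorem det_restrictScalars_smulRight (c : ℂ) :
    (((1 : ℂ →L[ℂ] ℂ).smulRight c).restrictScalars ℝ).det = ‖c‖ ^ 2 := by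
  have h : (((1 : ℂ →L[ℂ] ℂ).smulRight c).restrictScalars ℝ : ℂ →ₗ[ℝ] ℂ) =
      (LinearMap.mulLeft ℝ c) := by
    ext; simp [mul_comm]
  rw [ContinuousLinearMap.det, h, ← Complex.normSq_eq_norm_sq, ← Algebra.norm_complex_apply]
  rfl

/-- Holomorphic change of variables. -/
theorem setIntegral_image_of_holomorphic {U : Set ℂ} (hU : IsOpen U) {f : ℂ → ℂ}
    (hf : DifferentiableOn ℂ f U) (hinj : InjOn f U) (u : ℂ → ℝ) :
    ∫ w in f '' U, u w = ∫ z in U, ‖deriv f z‖ ^ 2 * u (f z) := by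
  rw [integral_image_eq_integral_abs_det_fderiv_smul volume hU.measurableSet
    (f' := fun z => ((1 : ℂ →L[ℂ] ℂ).smulRight (deriv f z)).restrictScalars ℝ)
    (fun z hz => ((hf.differentiableAt (hU.mem_nhds hz)).hasDerivAt.hasFDerivAt.restrictScalars
      ℝ).hasFDerivWithinAt) hinj]
  simp [det_restrictScalars_smulRight]

theorem integrableOn_image_of_holomorphic {U : Set ℂ} (hU : IsOpen U) {f : ℂ → ℂ}
    (hf : DifferentiableOn ℂ f U) (hinj : InjOn f U) (u : ℂ → ℝ) :
    IntegrableOn u (f '' U) ↔ IntegrableOn (fun z => ‖deriv f z‖ ^ 2 * u (f z)) U := by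
  rw [integrableOn_image_iff_integrableOn_abs_det_fderiv_smul volume hU.measurableSet
    (f' := fun z => ((1 : ℂ →L[ℂ] ℂ).smulRight (deriv f z)).restrictScalars ℝ)
    (fun z hz => ((hf.differentiableAt (hU.mem_nhds hz)).hasDerivAt.hasFDerivAt.restrictScalars
      ℝ).hasFDerivWithinAt) hinj]
  simp [det_restrictScalars_smulRight]

theorem enorm_sq_mul_le_lintegral_circle {r s : ℝ} (hs : 0 < s) (hsr : s < r) {h : ℂ → ℂ}
    (hh : DifferentiableOn ℂ h (ball 0 r)) :
    ENNReal.ofReal (2 * Real.pi) * ‖h 0‖ₑ ^ 2 ≤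
      ∫⁻ θ in Ioo (-Real.pi) Real.pi, ‖h (Complex.polarCoord.symm (s, θ))‖ₑ ^ 2 := by
  have h1 : Real.circleAverage (fun z => h z ^ 2) 0 s = h 0 ^ 2 := by
    refine DiffContOnCl.circleAverage ?_
    refine DifferentiableOn.diffContOnCl ?_
    rw [abs_of_pos hs, closure_ball _ hs.ne']
    exact (hh.mono (closedBall_subset_ball hsr)).pow 2
  rw [Real.circleAverage_def] at h1
  have h2 : ∫ θ in Ioo (-Real.pi) Real.pi, h (Complex.polarCoord.symm (s, θ)) ^ 2 =
      (2 * Real.pi : ℝ) • h 0 ^ 2 := by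
    rw [← h1, smul_inv_smul₀ (by positivity), ← integral_Ioc_eq_integral_Ioo,
      ← intervalIntegral.integral_of_le (by linarith [Real.pi_pos])]
    have hper : Function.Periodic (fun θ => h (circleMap 0 s θ) ^ 2) (2 * Real.pi) := by
      intro θ
      simp only [periodic_circleMap 0 s θ]
    have h3 := hper.intervalIntegral_add_eq (-Real.pi) 0
    rw [zero_add, show -Real.pi + 2 * Real.pi = Real.pi by ring] at h3
    rw [← h3]
    congr 1
    ext θ
    simp [circleMap, Complex.exp_mul_I]
  have h3 := enorm_integral_le_lintegral_enorm (μ := volume.restrict (Ioo (-Real.pi) Real.pi))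
    (fun θ => h (Complex.polarCoord.symm (s, θ)) ^ 2)
  rw [h2, enorm_smul] at h3
  simpa [enorm_pow, Real.enorm_eq_ofReal (show 0 ≤ 2 * Real.pi by positivity)] using h3

/-- Area mean value inequality. -/
theorem norm_sq_mul_area_le {r : ℝ} (hr : 0 < r) {h : ℂ → ℂ}
    (hh : DifferentiableOn ℂ h (ball 0 r)) (hint : IntegrableOn (fun z => ‖h z‖ ^ 2) (ball 0 r)) :
    ‖h 0‖ ^ 2 * (Real.pi * r ^ 2) ≤ ∫ z in ball (0 : ℂ) r, ‖h z‖ ^ 2 := by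
  classical
  set F : ℂ → ENNReal := (ball (0 : ℂ) r).indicator (fun z => ‖h z‖ₑ ^ 2) with hF
  have hFm : Measurable F := by
    have : F = (ball (0 : ℂ) r).piecewise (fun z => ‖h z‖ₑ ^ 2) 0 := by
      ext z; simp [hF, piecewise, indicator]
    rw [this]
    refine ContinuousOn.measurable_piecewise ?_ continuousOn_const measurableSet_ball
    exact (ENNReal.continuous_pow 2).comp_continuousOn hh.continuousOn.enorm
  have h1 : ∫⁻ z in ball (0 : ℂ) r, ‖h z‖ₑ ^ 2 = ∫⁻ s in Ioi (0 : ℝ),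
      ∫⁻ θ in Ioo (-Real.pi) Real.pi, ENNReal.ofReal s * F (Complex.polarCoord.symm (s, θ)) := by
    rw [← lintegral_indicator measurableSet_ball, ← Complex.lintegral_comp_polarCoord_symm]
    rw [polarCoord_target, Measure.volume_eq_prod, ← Measure.prod_restrict, lintegral_prod]
    · rfl
    · refine Measurable.aemeasurable ?_
      refine (ENNReal.measurable_ofReal.comp measurable_fst).mul (hFm.comp ?_)
      have hc : Continuous fun p : ℝ × ℝ => Complex.polarCoord.symm p := by
        simp only [Complex.polarCoord_symm_apply]
        fun_prop
      exact hc.measurable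
  have h2 : ENNReal.ofReal (‖h 0‖ ^ 2 * (Real.pi * r ^ 2)) ≤
      ∫⁻ z in ball (0 : ℂ) r, ‖h z‖ₑ ^ 2 := by
    rw [h1]
    calc ENNReal.ofReal (‖h 0‖ ^ 2 * (Real.pi * r ^ 2))
        = ∫⁻ s in Ioo 0 r, ENNReal.ofReal s * (ENNReal.ofReal (2 * Real.pi) * ‖h 0‖ₑ ^ 2) := by
          rw [lintegral_mul_const _ (by fun_prop), ← ofReal_integral_eq_lintegral_ofReal,
            ← integral_Ioc_eq_integral_Ioo, ← intervalIntegral.integral_of_le hr.le, integral_id,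
            ← ofReal_norm, ← ENNReal.ofReal_pow (norm_nonneg _),
            ← ENNReal.ofReal_mul (by positivity), ← ENNReal.ofReal_mul]
          · congr 1; ring
          · simp only [zero_pow two_ne_zero, sub_zero]; positivity
          · exact (continuous_id.integrableOn_Icc).mono_set Ioo_subset_Icc_self
          · filter_upwards [ae_restrict_mem measurableSet_Ioo] with s hs using hs.1.le
      _ ≤ ∫⁻ s in Ioo 0 r, ∫⁻ θ in Ioo (-Real.pi) Real.pi,
            ENNReal.ofReal s * F (Complex.polarCoord.symm (s, θ)) := by
          refine setLIntegral_mono' measurableSet_Ioo fun s hs => ?_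
          rw [lintegral_const_mul' _ _ ENNReal.ofReal_ne_top]
          gcongr
          refine (enorm_sq_mul_le_lintegral_circle hs.1 hs.2 hh).trans_eq ?_
          refine lintegral_congr fun θ => ?_
          rw [hF, indicator_of_mem]
          rw [mem_ball_zero_iff, Complex.norm_polarCoord_symm, abs_of_pos hs.1]
          exact hs.2
      _ ≤ _ := lintegral_mono_set fun s hs => hs.1
  have h3 : ∫⁻ z in ball (0 : ℂ) r, ‖h z‖ₑ ^ 2 =
      ENNReal.ofReal (∫ z in ball (0 : ℂ) r, ‖h z‖ ^ 2) := by
    rw [ofReal_integral_eq_lintegral_ofReal hint (by filter_upwards with z using by positivity)]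
    refine lintegral_congr fun z => ?_
    rw [ENNReal.ofReal_pow (norm_nonneg _), ofReal_norm]
  rw [h3] at h2
  exact (ENNReal.ofReal_le_ofReal_iff (by positivity)).1 h2

/-- The value at `z₀` of a square integrable holomorphic function on `G` is controlled by its
norm and the inner conformal radius. -/
theorem norm_sq_mul_area_le_setIntegral {G : Set ℂ} (hG : IsOpen G) {z₀ : ℂ} (hz₀ : z₀ ∈ G)
    {R : ℝ} (hR : 0 < R) {φ : ℂ → ℂ} (hφd : DifferentiableOn ℂ φ G) (hφ : BijOn φ G (ball 0 R))
    (h0 : φ z₀ = 0) (h1 : deriv φ z₀ = 1) {p : ℂ → ℂ} (hp : DifferentiableOn ℂ p G)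
    (hint : IntegrableOn (fun z => ‖p z‖ ^ 2) G) :
    ‖p z₀‖ ^ 2 * (Real.pi * R ^ 2) ≤ ∫ z in G, ‖p z‖ ^ 2 := by
  set ψ := Function.invFunOn φ G
  have hleft : LeftInvOn ψ φ G := hφ.injOn.leftInvOn_invFunOn
  have hderiv := fun z hz => (hasDerivAt_leftInvOn_of_injOn hG hφd hleft (z := z) hz).2.2
  have hψ : DifferentiableOn ℂ ψ (ball 0 R) := by
    rw [← hφ.image_eq]
    rintro _ ⟨z, hz, rfl⟩
    exact (hderiv z hz).differentiableAt.differentiableWithinAt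
  have hψ0 : ψ 0 = z₀ := by rw [← h0, hleft hz₀]
  have hψ1 : deriv ψ 0 = 1 := by
    have := (hderiv z₀ hz₀).deriv
    rwa [h0, h1, inv_one] at this
  have himg : ψ '' ball 0 R = G := by rw [← hφ.image_eq, hleft.image_image]
  have hinj : InjOn ψ (ball 0 R) := (hφ.surjOn.rightInvOn_invFunOn).injOn
  have hmaps : MapsTo ψ (ball 0 R) G := fun z hz => himg ▸ mem_image_of_mem ψ hz
  have key := norm_sq_mul_area_le hR (h := fun z => deriv ψ z * p (ψ z))
    ((hψ.deriv isOpen_ball).mul (hp.comp hψ hmaps)) ?_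
  · simp only [hψ1, hψ0, one_mul, norm_mul, mul_pow] at key
    rwa [← setIntegral_image_of_holomorphic isOpen_ball hψ hinj (fun z => ‖p z‖ ^ 2), himg] at key
  · simp only [norm_mul, mul_pow]
    rw [← integrableOn_image_of_holomorphic isOpen_ball hψ hinj (fun z => ‖p z‖ ^ 2), himg]
    exact hint

theorem integrableOn_of_continuous_of_isBounded {G : Set ℂ} (hG : Bornology.IsBounded G)
    {E : Type*} [NormedAddCommGroup E] {u : ℂ → E} (hu : Continuous u) : IntegrableOn u G :=
  (hu.continuousOn.integrableOn_compact hG.isCompact_closure).mono_set subset_closure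

theorem AreaOrthonormalPolys.integral_norm_sq_sum {G : Set ℂ} (hG : Bornology.IsBounded G)
    {K : ℕ → ℂ[X]} (hK : AreaOrthonormalPolys G K) (s : Finset ℕ) (c : ℕ → ℂ) :
    ∫ z in G, ‖(∑ k ∈ s, C (c k) * K k).eval z‖ ^ 2 = ∑ k ∈ s, ‖c k‖ ^ 2 := by
  have h1 : ∀ z, ((‖(∑ k ∈ s, C (c k) * K k).eval z‖ ^ 2 : ℝ) : ℂ) =
      ∑ j ∈ s, ∑ k ∈ s, (c j * conj (c k)) * ((K j).eval z * conj ((K k).eval z)) := by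
    intro z
    rw [Complex.ofReal_pow, ← Complex.mul_conj', eval_finsetSum, map_sum, Finset.sum_mul_sum]
    refine Finset.sum_congr rfl fun j _ => Finset.sum_congr rfl fun k _ => ?_
    simp only [eval_mul, eval_C, map_mul]
    ring
  have hint : ∀ j k, IntegrableOn (fun z => (c j * conj (c k)) *
      ((K j).eval z * conj ((K k).eval z))) G := fun j k =>
    integrableOn_of_continuous_of_isBounded hG (by
      have := (K j).continuous
      have := (K k).continuous
      fun_prop)
  have h2 : ((∫ z in G, ‖(∑ k ∈ s, C (c k) * K k).eval z‖ ^ 2 : ℝ) : ℂ) =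
      ((∑ k ∈ s, ‖c k‖ ^ 2 : ℝ) : ℂ) := by
    rw [← integral_complex_ofReal]
    simp_rw [h1]
    rw [integral_finsetSum _ fun j _ => integrable_finsetSum _ fun k _ => hint j k]
    push_cast
    refine Finset.sum_congr rfl fun j hj => ?_
    rw [integral_finsetSum _ fun k _ => hint j k]
    simp_rw [integral_const_mul, hK.2.2]
    simp [hj, Complex.mul_conj']
  exact_mod_cast h2

theorem AreaOrthonormalPolys.exists_eq_sum {G : Set ℂ} {K : ℕ → ℂ[X]}
    (hK : AreaOrthonormalPolys G K) (q : ℂ[X]) :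
    ∃ (s : Finset ℕ) (c : ℕ → ℂ), q = ∑ k ∈ s, C (c k) * K k := by
  have hne : ∀ n, K n ≠ 0 := fun n h => by
    obtain ⟨a, ha, h2⟩ := hK.2.1 n
    rw [h, leadingCoeff_zero] at h2
    exact ha.ne' (by exact_mod_cast h2.symm)
  let S : Polynomial.Sequence ℂ :=
    ⟨K, fun n => by rw [degree_eq_natDegree (hne n), hK.1 n]⟩
  have hq : q ∈ Submodule.span ℂ (range K) := by
    have := S.span fun n => (leadingCoeff_ne_zero.2 (hne n)).isUnit
    change q ∈ Submodule.span ℂ (range S)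
    rw [this]; trivial
  obtain ⟨c, hc⟩ := Finsupp.mem_span_range_iff_exists_finsupp.1 hq
  exact ⟨c.support, c, by rw [← hc, Finsupp.sum]; simp [smul_eq_C_mul]⟩

theorem AreaOrthonormalPolys.sum_norm_sq_le {G : Set ℂ} (hG : IsOpen G)
    (hGb : Bornology.IsBounded G) {K : ℕ → ℂ[X]} (hK : AreaOrthonormalPolys G K) {z₀ : ℂ}
    (hz₀ : z₀ ∈ G) {R : ℝ} (hR : 0 < R) {φ : ℂ → ℂ} (hφd : DifferentiableOn ℂ φ G)
    (hφ : BijOn φ G (ball 0 R)) (h0 : φ z₀ = 0) (h1 : deriv φ z₀ = 1) (s : Finset ℕ) :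
    ∑ k ∈ s, ‖(K k).eval z₀‖ ^ 2 ≤ 1 / (Real.pi * R ^ 2) := by
  set T := ∑ k ∈ s, ‖(K k).eval z₀‖ ^ 2
  set p : ℂ[X] := ∑ k ∈ s, C (conj ((K k).eval z₀)) * K k
  have hT0 : 0 ≤ T := Finset.sum_nonneg fun _ _ => by positivity
  have hp0 : p.eval z₀ = (T : ℂ) := by
    simp only [p, T, eval_finsetSum, eval_mul, eval_C, Complex.conj_mul']
    push_cast
    rfl
  have hp2 : ∫ z in G, ‖p.eval z‖ ^ 2 = T := by
    simp only [p, hK.integral_norm_sq_sum hGb s, RCLike.norm_conj, T]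
  have := norm_sq_mul_area_le_setIntegral hG hz₀ hR hφd hφ h0 h1 (p := fun z => p.eval z)
    p.differentiable.differentiableOn
    (integrableOn_of_continuous_of_isBounded hGb (p.continuous.norm.pow 2))
  rw [hp2, hp0, Complex.norm_real, Real.norm_of_nonneg hT0] at this
  rcases hT0.eq_or_lt with h | h
  · rw [← h]; positivity
  · rw [le_div_iff₀ (by positivity)]
    nlinarith

theorem AreaOrthonormalPolys.exists_one_le_mul_sum {G : Set ℂ}
    (hGb : Bornology.IsBounded G) {K : ℕ → ℂ[X]} (hK : AreaOrthonormalPolys G K) (q : ℂ[X])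
    (z₀ : ℂ) :
    ∃ s : Finset ℕ, ‖q.eval z₀‖ ^ 2 ≤
      (∫ z in G, ‖q.eval z‖ ^ 2) * ∑ k ∈ s, ‖(K k).eval z₀‖ ^ 2 := by
  obtain ⟨s, c, rfl⟩ := hK.exists_eq_sum q
  refine ⟨s, ?_⟩
  rw [hK.integral_norm_sq_sum hGb]
  calc ‖(∑ k ∈ s, C (c k) * K k).eval z₀‖ ^ 2
      ≤ (∑ k ∈ s, ‖c k‖ * ‖(K k).eval z₀‖) ^ 2 := by
        gcongr
        simp only [eval_finsetSum, eval_mul, eval_C]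
        exact (norm_sum_le _ _).trans_eq (by simp only [norm_mul])
    _ ≤ _ := Finset.sum_mul_sq_le_sq_mul_sq _ _ _

theorem isSimplyConnected_univ_of_contractibleSpace {X : Type*} [TopologicalSpace X]
    [ContractibleSpace X] : IsSimplyConnected (univ : Set X) := by
  have : ContractibleSpace (univ : Set X) := (Homeomorph.Set.univ X).contractibleSpace
  exact SimplyConnectedSpace.ofContractible _

theorem isPreconnected_setOf_lt_norm (R : ℝ) :
    IsPreconnected {z : ℂ | R < ‖z‖} := by
  have h : {z : ℂ | R < ‖z‖} =
      (fun p : ℝ × ℝ => (p.1 : ℂ) * Complex.exp (p.2 * Complex.I)) '' (Ioi R ×ˢ univ) := by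
    ext z
    constructor
    · intro hz
      exact ⟨(‖z‖, z.arg), ⟨hz, mem_univ _⟩, Complex.norm_mul_exp_arg_mul_I z⟩
    · rintro ⟨⟨r, t⟩, ⟨hr, -⟩, rfl⟩
      have hr' : R < r := hr
      simp only [mem_ofPred_eq, norm_mul, Complex.norm_exp_ofReal_mul_I, mul_one,
        Complex.norm_real, Real.norm_eq_abs]
      exact hr'.trans_le (le_abs_self r)
  rw [h]
  exact (isPreconnected_Ioi.prod isPreconnected_univ).image _ (by fun_prop)

/-- A continuous function on the plane which agrees with `z - q` near infinity has a zero. -/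
theorem exists_eq_zero_of_eq_sub {H : ℂ → ℂ} (hH : Continuous H) {q : ℂ} {R : ℝ}
    (hq : ∀ z, R < ‖z‖ → H z = z - q) : ∃ z, H z = 0 := by
  by_contra! hne
  obtain ⟨l, hl, hexp⟩ := Complex.exists_continuousOn_eqOn_exp_comp (U := univ)
    isSimplyConnected_univ_of_contractibleSpace isOpen_univ hH.continuousOn
    (by simpa using hne)
  rw [continuousOn_univ] at hl
  set r : ℝ := |R| + ‖q‖ + 1
  have hr : 0 < r := by positivity
  have hcirc : ∀ t : ℝ, Complex.exp (l (circleMap q r t)) = r * Complex.exp (t * Complex.I) := by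
    intro t
    have h1 : H (circleMap q r t) = circleMap q r t - q := by
      refine hq _ ?_
      have h2 : ‖circleMap q r t - q‖ = r := by simp [circleMap, abs_of_pos hr]
      have h3 := norm_sub_le (circleMap q r t) q
      have := le_abs_self R
      linarith
    rw [← Function.comp_apply (f := Complex.exp), hexp (mem_univ _), h1]
    simp [circleMap]
  set m : ℝ → ℂ := fun t => l (circleMap q r t) - t * Complex.I - Real.log r
  have hm : Continuous m := by
    have := continuous_circleMap q r
    fun_prop
  have hm1 : ∀ t, Complex.exp (m t) = 1 := by
    intro t
    have hr' : (r : ℂ) ≠ 0 := by exact_mod_cast hr.ne'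
    simp only [m]
    rw [Complex.exp_sub, Complex.exp_sub, hcirc, ← Complex.ofReal_exp, Real.exp_log hr]
    field_simp
  have hint : ∀ t, ∃ n : ℤ, (m t).im / (2 * Real.pi) = n := by
    intro t
    obtain ⟨n, hn⟩ := Complex.exp_eq_one_iff.1 (hm1 t)
    refine ⟨n, ?_⟩
    rw [hn]
    simp
  choose n hn using hint
  have hnc : Continuous n := by
    rw [Int.isClosedEmbedding_coe_real.isEmbedding.continuous_iff]
    have : ((↑) : ℤ → ℝ) ∘ n = fun t => (m t).im / (2 * Real.pi) := by
      ext t; exact (hn t).symm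
    rw [this]
    fun_prop
  have hconst : n 0 = n (2 * Real.pi) :=
    (isPreconnected_univ.image n hnc.continuousOn).subsingleton ⟨0, trivial, rfl⟩
      ⟨_, trivial, rfl⟩
  have h0 := hn 0
  have h2 := hn (2 * Real.pi)
  rw [← hconst, ← h0] at h2
  have hper : circleMap q r (2 * Real.pi) = circleMap q r 0 := by
    simpa using periodic_circleMap q r 0
  have hpi := Real.pi_pos
  rw [div_left_inj' (by positivity)] at h2
  simp only [m, hper] at h2
  simp at h2

/-- A Jordan curve is contained in the closure of every open set which contains a neighborhood of
infinity, misses some point off the curve, and has its frontier on the curve. -/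
theorem range_subset_closure_of_frontier_subset {γ : C(sphere (0 : ℂ) 1, ℂ)}
    (hγ : Function.Injective γ) {E : Set ℂ} (hE : frontier E ⊆ range γ) {R : ℝ}
    (hR : {z : ℂ | R < ‖z‖} ⊆ E) {q : ℂ} (hqE : q ∉ E) (hqγ : q ∉ range γ) :
    range γ ⊆ closure E := by
  classical
  rintro _ ⟨s, rfl⟩
  by_contra hs
  have hs1 : ‖(s : ℂ)‖ = 1 := by simp
  have hs0 : (s : ℂ) ≠ 0 := by rw [← norm_ne_zero_iff, hs1]; exact one_ne_zero
  have hmem : ∀ t : ℝ, -(s : ℂ) * Complex.exp (t * Complex.I) ∈ sphere (0 : ℂ) 1 := by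
    intro t; simp [hs1, Complex.norm_exp_ofReal_mul_I]
  have hΓ : Continuous fun t : ℝ => γ ⟨_, hmem t⟩ - q := by
    refine (γ.continuous.comp (Continuous.subtype_mk ?_ _)).sub continuous_const
    fun_prop
  obtain ⟨L, hL, hexp⟩ := Complex.exists_continuousOn_eqOn_exp_comp (U := univ)
    isSimplyConnected_univ_of_contractibleSpace isOpen_univ hΓ.continuousOn (by
      rintro ⟨t, -, ht⟩
      exact hqγ ⟨_, sub_eq_zero.1 ht⟩)
  rw [continuousOn_univ] at hL
  let e := (γ.continuous.isClosedEmbedding hγ).isEmbedding.toHomeomorph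
  have heγ : ∀ x : range γ, γ (e.symm x) = x := fun x =>
    congrArg Subtype.val (e.apply_symm_apply x)
  let σ : frontier E → sphere (0 : ℂ) 1 := fun a => e.symm ⟨a, hE a.2⟩
  have hσ : Continuous σ := e.symm.continuous.comp (by fun_prop)
  have hγσ : ∀ a, γ (σ a) = a := fun a => heγ _
  let ω : frontier E → ℂ := fun a => -(σ a : ℂ) / s
  have hω1 : ∀ a, ‖ω a‖ = 1 := fun a => by
    have : ‖(σ a : ℂ)‖ = 1 := by simp
    simp [ω, hs1, this]
  have hωslit : ∀ a, ω a ∈ Complex.slitPlane := by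
    intro a
    rw [Complex.mem_slitPlane_iff_arg]
    refine ⟨fun harg => ?_, by rw [← norm_ne_zero_iff, hω1]; exact one_ne_zero⟩
    have h1 : ω a = -1 := by
      rw [← Complex.norm_mul_exp_arg_mul_I (ω a), harg, hω1]; simp
    have h2 : σ a = s := by
      apply Subtype.ext
      simp only [ω] at h1
      rw [div_eq_iff hs0] at h1
      simpa using h1
    apply hs
    rw [← h2, hγσ]
    exact frontier_subset_closure a.2
  have hωc : Continuous ω := by
    have : Continuous fun a => (σ a : ℂ) := continuous_subtype_val.comp hσ
    fun_prop
  have hargc : Continuous fun a => (ω a).arg :=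
    continuous_iff_continuousAt.2 fun a =>
      (Complex.continuousAt_arg (hωslit a)).comp hωc.continuousAt
  obtain ⟨g, hg⟩ := ContinuousMap.exists_restrict_eq isClosed_frontier
    (⟨fun a => L ((ω a).arg), hL.comp hargc⟩ : C(frontier E, ℂ))
  have hgexp : ∀ a ∈ frontier E, a - q = Complex.exp (g a) := by
    intro a ha
    have h1 : g a = L ((ω ⟨a, ha⟩).arg) := congrArg (fun f : C(frontier E, ℂ) => f ⟨a, ha⟩) hg
    have h2 := hexp (mem_univ (ω ⟨a, ha⟩).arg)
    rw [h1]
    refine Eq.trans ?_ h2.symm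
    have h3 : (⟨_, hmem (ω ⟨a, ha⟩).arg⟩ : sphere (0 : ℂ) 1) = σ ⟨a, ha⟩ := by
      apply Subtype.ext
      have h4 := Complex.norm_mul_exp_arg_mul_I (ω ⟨a, ha⟩)
      rw [hω1, Complex.ofReal_one, one_mul] at h4
      simp only [h4]
      simp only [ω]
      field_simp
    simp only [h3, hγσ]
  have hHc : Continuous fun z => if z ∈ E then z - q else Complex.exp (g z) :=
    Continuous.if hgexp (by fun_prop) (by fun_prop)
  obtain ⟨z, hz⟩ := exists_eq_zero_of_eq_sub hHc (q := q) (R := R)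
    fun z hz => by rw [if_pos (hR hz)]
  split_ifs at hz with hzE
  · exact hqE (by rwa [← sub_eq_zero.1 hz])
  · exact Complex.exp_ne_zero _ hz

/-- A compact set with connected complement has arbitrarily small compact neighborhoods with
connected complement. -/
theorem exists_isCompact_between_of_isPreconnected_compl {K V : Set ℂ} (hK : IsCompact K)
    (hne : K.Nonempty) (hc : IsPreconnected Kᶜ) (hV : IsOpen V) (hKV : K ⊆ V) :
    ∃ K', IsCompact K' ∧ K ⊆ interior K' ∧ K' ⊆ V ∧ IsPreconnected K'ᶜ := by
  obtain ⟨R, hR0, hR⟩ := hK.isBounded.exists_pos_norm_le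
  let U : ℕ → Set ℂ := fun n => {z | 1 / ((n : ℝ) + 1) < infDist z K}
  have hUo : ∀ n, IsOpen (U n) := fun n => isOpen_lt continuous_const (continuous_infDist_pt K)
  have hUmono : Monotone U := by
    intro m n hmn z hz
    have hz' : 1 / ((m : ℝ) + 1) < infDist z K := hz
    exact (one_div_le_one_div_of_le (by positivity) (by gcongr)).trans_lt hz'
  have hfar : ∀ n, {z : ℂ | R + 1 < ‖z‖} ⊆ U n := by
    intro n z hz
    have h1 : 1 / ((n : ℝ) + 1) ≤ 1 := by
      rw [div_le_one (by positivity)]; linarith [(n.cast_nonneg : (0 : ℝ) ≤ n)]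
    have h2 : ‖z‖ - R ≤ infDist z K := by
      rw [le_infDist hne]
      intro k hk
      rw [dist_eq_norm]
      linarith [norm_sub_norm_le z k, hR k hk]
    have h3 : R + 1 < ‖z‖ := hz
    change 1 / ((n : ℝ) + 1) < infDist z K
    linarith
  set p : ℂ := ((R + 2 : ℝ) : ℂ)
  have hp : R + 1 < ‖p‖ := by
    rw [Complex.norm_real, Real.norm_eq_abs]
    linarith [le_abs_self (R + 2)]
  let W : ℕ → Set ℂ := fun n => connectedComponentIn (U n) p
  have hWo : ∀ n, IsOpen (W n) := fun n => (hUo n).connectedComponentIn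
  have hWmono : Monotone W := fun m n hmn => connectedComponentIn_mono _ (hUmono hmn)
  have hWfar : ∀ n, {z : ℂ | R + 1 < ‖z‖} ⊆ W n := fun n =>
    (isPreconnected_setOf_lt_norm _).subset_connectedComponentIn hp (hfar n)
  have hpK : p ∈ Kᶜ := fun h => by linarith [hR p h]
  have hpc : IsPathConnected Kᶜ :=
    (hK.isClosed.isOpen_compl.isConnected_iff_isPathConnected).1 ⟨⟨p, hpK⟩, hc⟩
  have hcover : Kᶜ ⊆ ⋃ n, W n := by
    intro z hz
    obtain ⟨γ, hγ⟩ := hpc.joinedIn z hz p hpK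
    have hcomp : IsCompact (range γ) := isCompact_range γ.continuous
    obtain ⟨x, hx, hmin⟩ := hcomp.exists_isMinOn (range_nonempty γ)
      (continuous_infDist_pt K).continuousOn
    have hpos : 0 < infDist x K := by
      obtain ⟨t, rfl⟩ := hx
      exact (hK.isClosed.notMem_iff_infDist_pos hne).1 (hγ t)
    obtain ⟨n, hn⟩ := exists_nat_one_div_lt hpos
    refine mem_iUnion.2 ⟨n, ?_⟩
    exact (isPreconnected_range γ.continuous).subset_connectedComponentIn
      ⟨1, γ.target⟩ (fun y hy => hn.trans_le (hmin hy)) ⟨0, γ.source⟩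
  have hC : IsCompact (closedBall (0 : ℂ) (R + 1) \ V) := (isCompact_closedBall _ _).diff hV
  obtain ⟨n, hn⟩ := hC.elim_directed_cover W hWo
    (fun z hz => hcover fun h => hz.2 (hKV h)) hWmono.directed_le
  refine ⟨(W n)ᶜ, ?_, ?_, ?_, ?_⟩
  · refine (isCompact_closedBall (0 : ℂ) (R + 1)).of_isClosed_subset (hWo n).isClosed_compl ?_
    intro z hz
    rw [mem_closedBall_zero_iff]
    by_contra! h
    exact hz (hWfar n h)
  · refine Subset.trans ?_ (interior_maximal (s := (W n)ᶜ)
      (t := {z | infDist z K < 1 / ((n : ℝ) + 1)})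
      (fun z hz hzW => ?_) (isOpen_lt (continuous_infDist_pt K) continuous_const))
    · intro z hz
      rw [mem_ofPred_eq, infDist_zero_of_mem hz]
      positivity
    · have h1 : 1 / ((n : ℝ) + 1) < infDist z K := connectedComponentIn_subset (U n) p hzW
      have h2 : infDist z K < 1 / ((n : ℝ) + 1) := hz
      exact lt_asymm h1 h2
  · intro z hz
    by_contra hzV
    by_cases h : R + 1 < ‖z‖
    · exact hz (hWfar n h)
    · exact hz (hn ⟨mem_closedBall_zero_iff.2 (not_lt.1 h), hzV⟩)
  · rw [compl_compl]
    exact isPreconnected_connectedComponentIn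

/-- The hull of a Jordan domain: a compact set with connected complement in which the domain
absorbs every connected open subset that meets it. -/
theorem IsJordanDomain.exists_hull {G : Set ℂ} (hG : IsJordanDomain G) :
    ∃ K, IsCompact K ∧ IsPreconnected Kᶜ ∧ closure G ⊆ K ∧
      ∀ O, IsOpen O → IsPreconnected O → O ⊆ K → (O ∩ G).Nonempty → O ⊆ G := by
  obtain ⟨hGo, hGb, hGs, γ, hγ, hγG⟩ := hG
  have hGconn : IsConnected G := by
    have : IsSimplyConnected G := hGs
    exact this.isPathConnected.isConnected
  obtain ⟨R, hR0, hR⟩ := (hGb.closure).exists_pos_norm_le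
  set p : ℂ := ((R + 1 : ℝ) : ℂ)
  have hp : R < ‖p‖ := by
    rw [Complex.norm_real, Real.norm_eq_abs]
    linarith [le_abs_self (R + 1)]
  have hclo : IsClosed (range γ) := hγG ▸ isClosed_frontier
  have hfar : {z : ℂ | R < ‖z‖} ⊆ (range γ)ᶜ := by
    intro z hz hzγ
    rw [hγG] at hzγ
    exact (hR z (frontier_subset_closure hzγ)).not_gt hz
  set E := connectedComponentIn (range γ)ᶜ p
  have hEo : IsOpen E := hclo.isOpen_compl.connectedComponentIn
  have hEc : IsPreconnected E := isPreconnected_connectedComponentIn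
  have hEfar : {z : ℂ | R < ‖z‖} ⊆ E :=
    (isPreconnected_setOf_lt_norm _).subset_connectedComponentIn hp hfar
  have hEsub : E ⊆ (range γ)ᶜ := connectedComponentIn_subset _ _
  have habs : ∀ O, IsPreconnected O → O ⊆ (range γ)ᶜ → (O ∩ G).Nonempty → O ⊆ G := by
    intro O hO hOγ hOG
    refine hO.subset_of_closure_inter_subset hGo hOG ?_
    rintro z ⟨hz, hzO⟩
    by_contra hzG
    refine hOγ hzO ?_
    rw [hγG, frontier, hGo.interior_eq]
    exact ⟨hz, hzG⟩
  have hEG : Disjoint E G := by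
    rw [disjoint_iff_inter_eq_empty, ← not_nonempty_iff_eq_empty]
    intro h
    have := habs E hEc hEsub h (hEfar hp)
    exact (hR p (subset_closure this)).not_gt hp
  have hfr : frontier E ⊆ range γ := by
    intro z hz
    by_contra hzγ
    rw [frontier, hEo.interior_eq] at hz
    refine hz.2 ?_
    have h1 : z ∈ (range γ)ᶜ := hzγ
    have h2 : IsOpen (connectedComponentIn (range γ)ᶜ z) := hclo.isOpen_compl.connectedComponentIn
    obtain ⟨y, hy, hyE⟩ := mem_closure_iff.1 hz.1 _ h2 (mem_connectedComponentIn h1)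
    have h3 := connectedComponentIn_eq hy
    have h4 := connectedComponentIn_eq hyE
    rw [← h3] at h4
    change z ∈ connectedComponentIn (range γ)ᶜ p
    rw [h4]
    exact mem_connectedComponentIn h1
  obtain ⟨q, hq⟩ := hGconn.nonempty
  have hqγ : q ∉ range γ := by
    rw [hγG, frontier, hGo.interior_eq]
    exact fun h => h.2 hq
  have hγE : range γ ⊆ closure E := range_subset_closure_of_frontier_subset hγ hfr hEfar
    (fun h => hEG.le_bot ⟨h, hq⟩) hqγ
  refine ⟨Eᶜ, ?_, by rwa [compl_compl], ?_, ?_⟩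
  · refine (isCompact_closedBall (0 : ℂ) R).of_isClosed_subset hEo.isClosed_compl fun z hz => ?_
    rw [mem_closedBall_zero_iff]
    by_contra! h
    exact hz (hEfar h)
  · exact closure_minimal hEG.symm.subset_compl_right hEo.isClosed_compl
  · intro O hO hOc hOE hOG
    refine habs O hOc (fun z hz hzγ => ?_) hOG
    obtain ⟨y, hyO, hyE⟩ := mem_closure_iff.1 (hγE hzγ) O hO hz
    exact hOE hyO hyE

/-- Uniform approximability by polynomials on `K`. -/
def PolyApprox (K : Set ℂ) (f : ℂ → ℂ) : Prop :=
  ∀ ε > 0, ∃ p : ℂ[X], ∀ z ∈ K, ‖f z - p.eval z‖ < ε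

namespace PolyApprox

variable {K : Set ℂ} {f g : ℂ → ℂ}

theorem eval (K : Set ℂ) (p : ℂ[X]) : PolyApprox K fun z => p.eval z :=
  fun ε hε => ⟨p, fun z _ => by simpa using hε⟩

theorem const (K : Set ℂ) (c : ℂ) : PolyApprox K fun _ => c := by
  simpa using eval K (C c)

theorem id (K : Set ℂ) : PolyApprox K fun z => z := by
  simpa using eval K X

theorem mono {L : Set ℂ} (hf : PolyApprox K f) (h : L ⊆ K) : PolyApprox L f := fun ε hε =>
  (hf ε hε).imp fun _ hp z hz => hp z (h hz)

theorem of_forall_exists (h : ∀ ε > 0, ∃ g, PolyApprox K g ∧ ∀ z ∈ K, ‖f z - g z‖ < ε) :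
    PolyApprox K f := by
  intro ε hε
  obtain ⟨g, hg, hfg⟩ := h (ε / 2) (by positivity)
  obtain ⟨p, hp⟩ := hg (ε / 2) (by positivity)
  refine ⟨p, fun z hz => ?_⟩
  have := norm_sub_le_norm_sub_add_norm_sub (f z) (g z) (p.eval z)
  linarith [hfg z hz, hp z hz]

theorem congr (hf : PolyApprox K f) (h : EqOn f g K) : PolyApprox K g := fun ε hε =>
  (hf ε hε).imp fun _ hp z hz => h hz ▸ hp z hz

theorem add (hf : PolyApprox K f) (hg : PolyApprox K g) : PolyApprox K fun z => f z + g z := by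
  intro ε hε
  obtain ⟨p, hp⟩ := hf (ε / 2) (by positivity)
  obtain ⟨q, hq⟩ := hg (ε / 2) (by positivity)
  refine ⟨p + q, fun z hz => ?_⟩
  rw [eval_add, add_sub_add_comm]
  have := norm_add_le (f z - p.eval z) (g z - q.eval z)
  linarith [hp z hz, hq z hz]

theorem continuousOn (hf : PolyApprox K f) : ContinuousOn f K := by
  refine continuousOn_of_uniform_approx_of_continuousOn fun u hu => ?_
  obtain ⟨ε, hε, h⟩ := Metric.mem_uniformity_dist.1 hu
  obtain ⟨p, hp⟩ := hf ε hε
  exact ⟨_, p.continuous.continuousOn, fun z hz => h (by rw [dist_eq_norm]; exact hp z hz)⟩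

theorem mul (hK : IsCompact K) (hf : PolyApprox K f) (hg : PolyApprox K g) :
    PolyApprox K fun z => f z * g z := by
  intro ε hε
  obtain ⟨M, hM⟩ := hK.exists_bound_of_continuousOn hf.continuousOn
  have hM' : 0 < |M| + 1 := by positivity
  obtain ⟨q, hq⟩ := hg (ε / 2 / (|M| + 1)) (by positivity)
  obtain ⟨N, hN⟩ := hK.exists_bound_of_continuousOn q.continuous.continuousOn
  have hN' : 0 < |N| + 1 := by positivity
  obtain ⟨p, hp⟩ := hf (ε / 2 / (|N| + 1)) (by positivity)
  refine ⟨p * q, fun z hz => ?_⟩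
  rw [eval_mul, show f z * g z - p.eval z * q.eval z =
    f z * (g z - q.eval z) + (f z - p.eval z) * q.eval z by ring]
  have h1 := norm_add_le (f z * (g z - q.eval z)) ((f z - p.eval z) * q.eval z)
  rw [norm_mul, norm_mul] at h1
  have h2 : ‖f z‖ * ‖g z - q.eval z‖ ≤ (|M| + 1) * ‖g z - q.eval z‖ := by
    gcongr; linarith [hM z hz, le_abs_self M]
  have h3 : ‖f z - p.eval z‖ * ‖q.eval z‖ ≤ ‖f z - p.eval z‖ * (|N| + 1) := by
    gcongr; linarith [hN z hz, le_abs_self N]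
  have h4 := hq z hz
  have h5 := hp z hz
  rw [lt_div_iff₀ hM'] at h4
  rw [lt_div_iff₀ hN'] at h5
  linarith

theorem const_mul (hK : IsCompact K) (c : ℂ) (hf : PolyApprox K f) :
    PolyApprox K fun z => c * f z :=
  (const K c).mul hK hf

theorem neg (hK : IsCompact K) (hf : PolyApprox K f) : PolyApprox K fun z => -f z := by
  simpa using hf.const_mul hK (-1)

theorem sub (hK : IsCompact K) (hf : PolyApprox K f) (hg : PolyApprox K g) :
    PolyApprox K fun z => f z - g z := by
  simpa [sub_eq_add_neg] using hf.add (hg.neg hK)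

theorem pow (hK : IsCompact K) (hf : PolyApprox K f) (n : ℕ) : PolyApprox K fun z => f z ^ n := by
  induction n with
  | zero => simpa using const K 1
  | succ n ih => simpa [pow_succ] using ih.mul hK hf

theorem sum {ι : Type*} (s : Finset ι) {F : ι → ℂ → ℂ} (hF : ∀ i ∈ s, PolyApprox K (F i)) :
    PolyApprox K fun z => ∑ i ∈ s, F i z := by
  classical
  induction s using Finset.induction_on with
  | empty => simpa using const K 0
  | insert i s hi ih =>
    simp only [Finset.sum_insert hi]
    exact (hF i (Finset.mem_insert_self _ _)).add
      (ih fun j hj => hF j (Finset.mem_insert_of_mem hj))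

theorem comp (hK : IsCompact K) (hf : PolyApprox K f) {c : ℂ} {r : ℝ}
    (hfr : MapsTo f K (ball c r)) {F : ℂ → ℂ} (hF : DifferentiableOn ℂ F (ball c r)) :
    PolyApprox K fun z => F (f z) := by
  rcases K.eq_empty_or_nonempty with rfl | hne
  · exact fun ε _ => ⟨0, by simp⟩
  obtain ⟨x, hx, hmax⟩ := hK.exists_isMaxOn hne
    (f := fun z => dist (f z) c)
    (by have := hf.continuousOn; fun_prop)
  have hxr : dist (f x) c < r := hfr hx
  obtain ⟨ρ, hρ1, hρ2⟩ := exists_between hxr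
  obtain ⟨t, ht1, ht2⟩ := exists_between hρ1
  have ht0 : 0 < t := dist_nonneg.trans_lt ht1
  have hρ0 : 0 < ρ := ht0.trans ht2
  lift ρ to NNReal using hρ0.le
  lift t to NNReal using ht0.le
  have hser := (hF.mono (closedBall_subset_ball hρ2)).hasFPowerSeriesOnBall
    (by exact_mod_cast hρ0)
  have hunif := hser.tendstoUniformlyOn (r' := t) (by exact_mod_cast ht2)
  refine of_forall_exists fun ε hε => ?_
  obtain ⟨n, hn⟩ := (Metric.tendstoUniformlyOn_iff.1 hunif ε hε).exists
  refine ⟨fun z => (cauchyPowerSeries F c ρ).partialSum n (f z - c), ?_, fun z hz => ?_⟩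
  · simp only [FormalMultilinearSeries.partialSum, FormalMultilinearSeries.apply_eq_pow_smul_coeff,
      smul_eq_mul]
    exact sum _ fun k _ => ((hf.sub hK (const K c)).pow hK k).mul hK (const K _)
  · have := hn (f z - c) (by
      rw [mem_ball_zero_iff, ← dist_eq_norm]
      exact (hmax hz).trans_lt ht1)
    rwa [add_sub_cancel, dist_eq_norm] at this

theorem cexp (hK : IsCompact K) (hf : PolyApprox K f) :
    PolyApprox K fun z => Complex.exp (f z) := by
  obtain ⟨M, hM⟩ := hK.exists_bound_of_continuousOn hf.continuousOn
  refine hf.comp hK (c := 0) (r := M + 1) (fun z hz => ?_)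
    Complex.differentiable_exp.differentiableOn
  rw [mem_ball_zero_iff]
  linarith [hM z hz]

theorem exists_tendstoUniformlyOn (hf : PolyApprox K f) :
    ∃ p : ℕ → ℂ[X], TendstoUniformlyOn (fun n z => (p n).eval z) f atTop K := by
  choose p hp using fun n : ℕ => hf (1 / ((n : ℝ) + 1)) (by positivity)
  refine ⟨p, Metric.tendstoUniformlyOn_iff.2 fun ε hε => ?_⟩
  have := (tendsto_one_div_add_atTop_nhds_zero_nat (𝕜 := ℝ)).eventually_lt_const hε
  filter_upwards [this] with n hn z hz
  rw [dist_eq_norm]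
  exact (hp n z hz).trans hn

theorem differentiableOn_interior (hf : PolyApprox K f) : DifferentiableOn ℂ f (interior K) := by
  obtain ⟨p, hp⟩ := hf.exists_tendstoUniformlyOn
  exact (hp.tendstoLocallyUniformlyOn.mono interior_subset).differentiableOn
    (.of_forall fun n => (p n).differentiable.differentiableOn) isOpen_interior

theorem deriv (hf : PolyApprox K f) {L : Set ℂ} (hL : IsCompact L) (hLK : L ⊆ interior K) :
    PolyApprox L (deriv f) := by
  obtain ⟨p, hp⟩ := hf.exists_tendstoUniformlyOn
  have h1 := (hp.tendstoLocallyUniformlyOn.mono interior_subset).deriv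
    (.of_forall fun n => (p n).differentiable.differentiableOn) isOpen_interior
  have h2 := (tendstoLocallyUniformlyOn_iff_forall_isCompact isOpen_interior).1 h1 L hLK hL
  intro ε hε
  obtain ⟨n, hn⟩ := (Metric.tendstoUniformlyOn_iff.1 h2 ε hε).exists
  refine ⟨derivative (p n), fun z hz => ?_⟩
  have := hn z hz
  simpa [dist_eq_norm] using this

end PolyApprox

/-- `h` has a logarithm on `K` which is uniformly approximable by polynomials. -/
def HasPolyApproxLog (K : Set ℂ) (h : ℂ → ℂ) : Prop :=
  ∃ g, PolyApprox K g ∧ ∀ z ∈ K, Complex.exp (g z) = h z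

namespace HasPolyApproxLog

variable {K : Set ℂ} {f g h : ℂ → ℂ}

theorem congr (hf : HasPolyApproxLog K f) (hfg : EqOn f g K) : HasPolyApproxLog K g := by
  obtain ⟨l, hl, hexp⟩ := hf
  exact ⟨l, hl, fun z hz => (hexp z hz).trans (hfg hz)⟩

theorem mul (hf : HasPolyApproxLog K f) (hg : HasPolyApproxLog K g) :
    HasPolyApproxLog K fun z => f z * g z := by
  obtain ⟨l, hl, hexp⟩ := hf
  obtain ⟨m, hm, hexp'⟩ := hg
  exact ⟨_, hl.add hm, fun z hz => by rw [Complex.exp_add, hexp z hz, hexp' z hz]⟩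

theorem inv (hK : IsCompact K) (hf : HasPolyApproxLog K f) : PolyApprox K fun z => (f z)⁻¹ := by
  obtain ⟨l, hl, hexp⟩ := hf
  exact ((hl.neg hK).cexp hK).congr fun z hz => by
    simp only [Complex.exp_neg, hexp z hz]

theorem const (K : Set ℂ) {c : ℂ} (hc : c ≠ 0) : HasPolyApproxLog K fun _ => c :=
  ⟨_, PolyApprox.const K (Complex.log c), fun _ _ => Complex.exp_log hc⟩

theorem of_norm_sub_one_lt (hK : IsCompact K) (hf : PolyApprox K f)
    (h1 : ∀ z ∈ K, ‖f z - 1‖ < 1) : HasPolyApproxLog K f := by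
  have hslit : ∀ w ∈ ball (1 : ℂ) 1, w ∈ Complex.slitPlane := fun w hw =>
    Complex.ball_one_subset_slitPlane hw
  have hmaps : MapsTo f K (ball 1 1) := fun z hz => by
    rw [mem_ball, dist_eq_norm]; exact h1 z hz
  refine ⟨_, hf.comp hK hmaps (F := Complex.log) fun w hw =>
    (Complex.differentiableAt_log (hslit w hw)).differentiableWithinAt, fun z hz =>
    Complex.exp_log (Complex.slitPlane_ne_zero (hslit _ (hmaps hz)))⟩

theorem sub_const (hK : IsCompact K) (hne : K.Nonempty) (hc : IsPreconnected Kᶜ) {a : ℂ}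
    (ha : a ∉ K) : HasPolyApproxLog K fun z => z - a := by
  set u : Set ℂ := {a | a ∉ K ∧ HasPolyApproxLog K fun z => z - a}
  have step : ∀ a ∈ u, ∀ b, dist b a < infDist a K → b ∈ u := by
    rintro a ⟨haK, ha⟩ b hb
    have hd : ∀ z ∈ K, dist b a < ‖z - a‖ := fun z hz => by
      rw [← dist_eq_norm, dist_comm z]
      exact hb.trans_le (infDist_le_dist_of_mem hz)
    have hz0 : ∀ z ∈ K, z - a ≠ 0 := fun z hz h => haK (sub_eq_zero.1 h ▸ hz)
    refine ⟨fun h => (hd b h).ne (dist_eq_norm _ _), ?_⟩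
    have h1 : HasPolyApproxLog K fun z => 1 + (a - b) * (z - a)⁻¹ := by
      refine of_norm_sub_one_lt hK ((PolyApprox.const K 1).add ((ha.inv hK).const_mul hK _))
        fun z hz => ?_
      rw [add_sub_cancel_left, norm_mul, norm_inv, ← div_eq_mul_inv,
        div_lt_one (norm_pos_iff.2 (hz0 z hz)), ← dist_eq_norm, dist_comm]
      exact hd z hz
    refine (ha.mul h1).congr fun z hz => ?_
    have := hz0 z hz
    field_simp
    ring
  have hKu : Kᶜ ⊆ u := by
    refine hc.subset_of_closure_inter_subset ?_ ?_ ?_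
    · refine Metric.isOpen_iff.2 fun a ha => ⟨infDist a K, ?_, fun b hb => step a ha b hb⟩
      exact (hK.isClosed.notMem_iff_infDist_pos hne).1 ha.1
    · obtain ⟨R, hR0, hR⟩ := hK.isBounded.exists_pos_norm_le
      have hR1 : ‖((R + 1 : ℝ) : ℂ)‖ = R + 1 := by
        rw [Complex.norm_real, Real.norm_of_nonneg (by linarith)]
      have ha0 : ((R + 1 : ℝ) : ℂ) ≠ 0 := by
        rw [← norm_ne_zero_iff, hR1]; positivity
      have haK : ((R + 1 : ℝ) : ℂ) ∉ K := fun h => by linarith [hR _ h]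
      refine ⟨((R + 1 : ℝ) : ℂ), haK, haK, ?_⟩
      have h1 : HasPolyApproxLog K fun z => 1 + (-((R + 1 : ℝ) : ℂ)⁻¹) * z := by
        refine of_norm_sub_one_lt hK ((PolyApprox.const K 1).add
          ((PolyApprox.id K).const_mul hK _)) fun z hz => ?_
        rw [add_sub_cancel_left, norm_mul, norm_neg, norm_inv, hR1, inv_mul_lt_one₀ (by positivity)]
        linarith [hR z hz]
      refine ((const K (neg_ne_zero.2 ha0)).mul h1).congr fun z _ => ?_
      field_simp
      ring
    · rintro b ⟨hb, hbK⟩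
      have hpos := (hK.isClosed.notMem_iff_infDist_pos hne).1 hbK
      obtain ⟨a, ha, hab⟩ := Metric.mem_closure_iff.1 hb (infDist b K / 2) (by positivity)
      refine step a ha b ?_
      linarith [infDist_le_infDist_add_dist (s := K) (x := b) (y := a)]
  exact (hKu ha).2

theorem eval (hK : IsCompact K) (hne : K.Nonempty) (hc : IsPreconnected Kᶜ) {p : ℂ[X]}
    (hp : ∀ z ∈ K, p.eval z ≠ 0) : HasPolyApproxLog K fun z => p.eval z := by
  have hp0 : p ≠ 0 := by
    rintro rfl
    obtain ⟨z, hz⟩ := hne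
    exact hp z hz (by simp)
  have key : ∀ s : Multiset ℂ, (∀ a ∈ s, a ∉ K) →
      HasPolyApproxLog K fun z => (s.map fun a => z - a).prod := by
    intro s
    induction s using Multiset.induction_on with
    | empty => intro _; simpa using const K one_ne_zero
    | cons a s ih =>
      intro hs
      simp only [Multiset.map_cons, Multiset.prod_cons]
      exact (sub_const hK hne hc (hs a (Multiset.mem_cons_self a s))).mul
        (ih fun b hb => hs b (Multiset.mem_cons_of_mem hb))
  refine ((const K (leadingCoeff_ne_zero.2 hp0)).mul (key p.roots fun a ha haK =>
    hp a haK (isRoot_of_mem_roots ha))).congr fun z _ => ?_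
  exact ((IsAlgClosed.splits p).eval_eq_prod_roots z).symm

/-- On a compact set with connected complement, a nonvanishing function which is a uniform limit
of polynomials has a logarithm which is a uniform limit of polynomials. -/
theorem of_ne_zero (hK : IsCompact K) (hne : K.Nonempty) (hc : IsPreconnected Kᶜ)
    (hh : PolyApprox K h) (h0 : ∀ z ∈ K, h z ≠ 0) : HasPolyApproxLog K h := by
  obtain ⟨x, hx, hmin⟩ := hK.exists_isMinOn hne hh.continuousOn.norm
  have hm : 0 < ‖h x‖ := norm_pos_iff.2 (h0 x hx)
  obtain ⟨p, hp⟩ := hh (‖h x‖ / 2) (by positivity)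
  have hpm : ∀ z ∈ K, ‖h z - p.eval z‖ < ‖p.eval z‖ := fun z hz => by
    have h1 : ‖h x‖ ≤ ‖h z‖ := hmin hz
    have h2 := norm_sub_norm_le (h z) (p.eval z)
    linarith [hp z hz]
  have hp0 : ∀ z ∈ K, p.eval z ≠ 0 := fun z hz =>
    norm_pos_iff.1 ((norm_nonneg _).trans_lt (hpm z hz))
  have hlog := eval hK hne hc hp0
  have h1 : HasPolyApproxLog K fun z => h z * (p.eval z)⁻¹ := by
    refine of_norm_sub_one_lt hK (hh.mul hK (hlog.inv hK)) fun z hz => ?_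
    have h2 := hp0 z hz
    rw [show h z * (p.eval z)⁻¹ - 1 = (h z - p.eval z) / p.eval z by field_simp, norm_div,
      div_lt_one (norm_pos_iff.2 h2)]
    exact hpm z hz
  refine (hlog.mul h1).congr fun z hz => ?_
  have := hp0 z hz
  field_simp

end HasPolyApproxLog

/-- If an injective holomorphic function `f`, normalized at `z₀`, covers a disk of radius `s` from a
subset `K` in which the open set `G` absorbs connected open sets, then `s` is at most the inner
conformal radius of `G`. -/
theorem le_of_ball_subset_image {G K U : Set ℂ} {z₀ : ℂ} (hz₀ : z₀ ∈ G) (hGK : G ⊆ K)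
    (hKG : ∀ O, IsOpen O → IsPreconnected O → O ⊆ K → (O ∩ G).Nonempty → O ⊆ G)
    {R : ℝ} {φ : ℂ → ℂ} (hφd : DifferentiableOn ℂ φ G) (hG : IsOpen G)
    (hφ : MapsTo φ G (ball 0 R)) (h0 : φ z₀ = 0) (h1 : deriv φ z₀ = 1)
    (hU : IsOpen U) (hKU : K ⊆ U) {f : ℂ → ℂ} (hf : DifferentiableOn ℂ f U) (hinj : InjOn f U)
    (hf0 : f z₀ = 0) (hf1 : deriv f z₀ = 1) {s : ℝ} (hs : 0 < s) (hsub : ball 0 s ⊆ f '' K) :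
    s ≤ R := by
  set g := Function.invFunOn f U
  have hleft : LeftInvOn g f U := hinj.leftInvOn_invFunOn
  have hder := fun z hz => (hasDerivAt_leftInvOn_of_injOn hU hf hleft (z := z) hz).2.2
  have hgd : DifferentiableOn ℂ g (ball 0 s) := by
    intro w hw
    obtain ⟨z, hz, rfl⟩ := hsub hw
    exact (hder z (hKU hz)).differentiableAt.differentiableWithinAt
  have hz₀U : z₀ ∈ U := hKU (hGK hz₀)
  have hg0 : g 0 = z₀ := by rw [← hf0, hleft hz₀U]
  have hg1 : HasDerivAt g 1 0 := by
    have := hder z₀ hz₀U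
    rwa [hf0, hf1, inv_one] at this
  have himg : g '' ball 0 s = U ∩ f ⁻¹' ball 0 s := by
    ext z
    constructor
    · rintro ⟨w, hw, rfl⟩
      obtain ⟨z, hz, rfl⟩ := hsub hw
      rw [hleft (hKU hz)]
      exact ⟨hKU hz, hw⟩
    · rintro ⟨hz, hw⟩
      exact ⟨f z, hw, hleft hz⟩
  have hmaps : g '' ball 0 s ⊆ G := by
    refine hKG _ ?_ ((convex_ball _ _).isPreconnected.image g hgd.continuousOn) ?_
      ⟨z₀, ⟨0, mem_ball_self hs, hg0⟩, hz₀⟩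
    · rw [himg]
      exact hf.continuousOn.isOpen_inter_preimage hU isOpen_ball
    · rintro _ ⟨w, hw, rfl⟩
      obtain ⟨z, hz, rfl⟩ := hsub hw
      rwa [hleft (hKU hz)]
  have hmaps' : MapsTo g (ball 0 s) G := fun w hw => hmaps (mem_image_of_mem g hw)
  have hφg : HasDerivAt (φ ∘ g) 1 0 := by
    have h2 := (hφd.differentiableAt (hG.mem_nhds hz₀)).hasDerivAt
    rw [h1, ← hg0] at h2
    simpa using h2.comp 0 hg1
  have := Complex.norm_deriv_le_div_of_mapsTo_ball (f := φ ∘ g) (R₂ := R) (hφd.comp hgd hmaps')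
    (fun w hw => by
      rw [Function.comp_apply, Function.comp_apply, hg0, h0]
      exact ball_subset_closedBall (hφ (hmaps' hw))) hs
  rwa [hφg.deriv, norm_one, one_le_div hs] at this

/-- The disk automorphism which vanishes at `a`. -/
noncomputable def blaschkeFactor (a z : ℂ) : ℂ := (z - a) / (1 - conj a * z)

section blaschkeFactor

variable {a z : ℂ}

theorem one_sub_conj_mul_ne_zero (ha : ‖a‖ < 1) (hz : ‖z‖ < 1) : 1 - conj a * z ≠ 0 := by
  intro h
  have h1 : ‖conj a * z‖ = 1 := by rw [← sub_eq_zero.1 h, norm_one]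
  rw [norm_mul, RCLike.norm_conj] at h1
  nlinarith [norm_nonneg a, norm_nonneg z]

theorem norm_blaschkeFactor_lt_one (ha : ‖a‖ < 1) (hz : ‖z‖ < 1) : ‖blaschkeFactor a z‖ < 1 := by
  have h0 := one_sub_conj_mul_ne_zero ha hz
  rw [blaschkeFactor, norm_div, div_lt_one (norm_pos_iff.2 h0)]
  refine lt_of_pow_lt_pow_left₀ 2 (norm_nonneg _) ?_
  have key : ‖1 - conj a * z‖ ^ 2 - ‖z - a‖ ^ 2 = (1 - ‖a‖ ^ 2) * (1 - ‖z‖ ^ 2) := by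
    simp only [← Complex.normSq_eq_norm_sq, Complex.normSq_apply, Complex.sub_re, Complex.sub_im,
      Complex.mul_re, Complex.mul_im, Complex.conj_re, Complex.conj_im, Complex.one_re,
      Complex.one_im]
    ring
  have h1 : 0 < (1 - ‖a‖ ^ 2) * (1 - ‖z‖ ^ 2) :=
    mul_pos (by nlinarith [norm_nonneg a]) (by nlinarith [norm_nonneg z])
  linarith

theorem injOn_blaschkeFactor (ha : ‖a‖ < 1) : InjOn (blaschkeFactor a) (ball 0 1) := by
  intro z hz w hw h
  rw [mem_ball_zero_iff] at hz hw
  have hz0 := one_sub_conj_mul_ne_zero ha hz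
  have hw0 := one_sub_conj_mul_ne_zero ha hw
  have ha0 := one_sub_conj_mul_ne_zero ha ha
  rw [blaschkeFactor, blaschkeFactor, div_eq_div_iff hz0 hw0] at h
  have : (z - w) * (1 - conj a * a) = 0 := by linear_combination h
  exact sub_eq_zero.1 ((mul_eq_zero.1 this).resolve_right ha0)

theorem hasDerivAt_blaschkeFactor (ha : ‖a‖ < 1) (hz : ‖z‖ < 1) :
    HasDerivAt (blaschkeFactor a) ((1 - ‖a‖ ^ 2 : ℝ) / (1 - conj a * z) ^ 2) z := by
  have h0 := one_sub_conj_mul_ne_zero ha hz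
  have h1 := ((hasDerivAt_id z).sub_const a).div
    (((hasDerivAt_id z).const_mul (conj a)).const_sub 1) h0
  refine h1.congr_deriv ?_
  push_cast
  rw [← Complex.conj_mul']
  simp only [id]
  ring

theorem differentiableOn_blaschkeFactor (ha : ‖a‖ < 1) :
    DifferentiableOn ℂ (blaschkeFactor a) (ball 0 1) := fun _ hz =>
  (hasDerivAt_blaschkeFactor ha (mem_ball_zero_iff.1 hz)).differentiableAt.differentiableWithinAt

end blaschkeFactor

/-- Near `K`, there is an injective function, normalized at `z₀`, of modulus less than `ρ`, which is
a uniform limit of polynomials. -/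
def HasNormalizedMap (K : Set ℂ) (z₀ : ℂ) (ρ : ℝ) : Prop :=
  ∃ K' f, IsCompact K' ∧ K ⊆ interior K' ∧ PolyApprox K' f ∧ InjOn f K' ∧ f z₀ = 0 ∧
    deriv f z₀ = 1 ∧ ∀ z ∈ K', ‖f z‖ < ρ

theorem HasNormalizedMap.mono {K : Set ℂ} {z₀ : ℂ} {ρ ρ' : ℝ} (h : HasNormalizedMap K z₀ ρ)
    (hρ : ρ ≤ ρ') : HasNormalizedMap K z₀ ρ' := by
  obtain ⟨K', f, h1, h2, h3, h4, h5, h6, h7⟩ := h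
  exact ⟨K', f, h1, h2, h3, h4, h5, h6, fun z hz => (h7 z hz).trans_le hρ⟩

theorem hasNormalizedMap_of_isCompact {K : Set ℂ} (hK : IsCompact K) (z₀ : ℂ) :
    ∃ ρ, HasNormalizedMap K z₀ ρ := by
  obtain ⟨K', hK', hKK'⟩ := exists_compact_superset hK
  obtain ⟨R, hR0, hR⟩ := hK'.isBounded.exists_pos_norm_le
  refine ⟨R + ‖z₀‖ + 1, K', fun z => z - z₀, hK', hKK',
    (PolyApprox.id K').sub hK' (.const K' z₀), fun _ _ _ _ h => by simpa using h, sub_self _,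
    by simp, fun z hz => ?_⟩
  linarith [norm_sub_le z z₀, hR z hz]

/-- Koebe's square root trick: an omitted value allows one to reduce the bound. -/
theorem koebe_step {K K' : Set ℂ} {z₀ : ℂ} {ρ : ℝ} (hK : IsCompact K) (hKc : IsPreconnected Kᶜ)
    (hz₀ : z₀ ∈ K) {f : ℂ → ℂ} (hKK' : K ⊆ interior K')
    (hf : PolyApprox K' f) (hinj : InjOn f K') (h0 : f z₀ = 0) (h1 : deriv f z₀ = 1)
    (hρ : ∀ z ∈ K', ‖f z‖ < ρ) {w : ℂ} (hw : ‖w‖ < ρ) (hwK : w ∉ f '' K) {τ : ℝ} (hτ0 : 0 < τ)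
    (hτ : τ ^ 2 = ‖w‖ / ρ) : HasNormalizedMap K z₀ (ρ * (2 * τ / (1 + τ ^ 2))) := by
  have hρ0 : 0 < ρ := (norm_nonneg _).trans_lt hw
  have hρc : (ρ : ℂ) ≠ 0 := by exact_mod_cast hρ0.ne'
  obtain ⟨L, hL, hKL, hLV, hLc⟩ := exists_isCompact_between_of_isPreconnected_compl hK ⟨z₀, hz₀⟩
    hKc (V := interior K' ∩ f ⁻¹' {w}ᶜ)
    (hf.differentiableOn_interior.continuousOn.isOpen_inter_preimage isOpen_interior
      isOpen_compl_singleton) fun z hz => ⟨hKK' hz, fun h => hwK ⟨z, hz, h⟩⟩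
  have hLK' : L ⊆ K' := fun z hz => interior_subset (hLV hz).1
  have hz₀L : z₀ ∈ L := interior_subset (hKL hz₀)
  have hLn : L ∈ 𝓝 z₀ := mem_interior_iff_mem_nhds.1 (hKL hz₀)
  set a : ℂ := w / ρ
  have hna : ‖a‖ = τ ^ 2 := by
    rw [hτ, norm_div, Complex.norm_real, Real.norm_of_nonneg hρ0.le]
  have ha : ‖a‖ < 1 := by rwa [hna, hτ, div_lt_one hρ0]
  set F : ℂ → ℂ := fun z => (ρ : ℂ)⁻¹ * f z
  have hFa : PolyApprox L F := (hf.mono hLK').const_mul hL _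
  have hF1 : ∀ z ∈ L, ‖F z‖ < 1 := fun z hz => by
    rw [norm_mul, norm_inv, Complex.norm_real, Real.norm_of_nonneg hρ0.le, inv_mul_lt_one₀ hρ0]
    exact hρ z (hLK' hz)
  have hFball : MapsTo F L (ball 0 1) := fun z hz => mem_ball_zero_iff.2 (hF1 z hz)
  set h : ℂ → ℂ := fun z => blaschkeFactor a (F z)
  have hh : PolyApprox L h := hFa.comp hL hFball (differentiableOn_blaschkeFactor ha)
  obtain ⟨l, hl, hexp⟩ := HasPolyApproxLog.of_ne_zero hL ⟨z₀, hz₀L⟩ hLc hh fun z hz => by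
    refine div_ne_zero (sub_ne_zero.2 fun hFz => (hLV hz).2 ?_)
      (one_sub_conj_mul_ne_zero ha (hF1 z hz))
    have : f z = ρ * F z := by simp only [F]; field_simp
    rw [mem_singleton_iff, this, hFz]
    simp only [a]
    field_simp
  set g : ℂ → ℂ := fun z => Complex.exp ((1 / 2 : ℂ) * l z)
  have hg : PolyApprox L g := (hl.const_mul hL _).cexp hL
  have hg2 : ∀ z ∈ L, g z ^ 2 = h z := fun z hz => by
    rw [← hexp z hz, ← Complex.exp_nat_mul]
    congr 1
    push_cast
    ring
  have hg1 : ∀ z ∈ L, ‖g z‖ < 1 := fun z hz => by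
    have h2 : ‖g z‖ ^ 2 < 1 := by
      rw [← norm_pow, hg2 z hz]
      exact norm_blaschkeFactor_lt_one ha (hF1 z hz)
    nlinarith [norm_nonneg (g z)]
  have hgball : MapsTo g L (ball 0 1) := fun z hz => mem_ball_zero_iff.2 (hg1 z hz)
  set b := g z₀
  have hF0 : F z₀ = 0 := by simp [F, h0]
  have hb2 : b ^ 2 = -a := by
    rw [hg2 z₀ hz₀L]
    simp [h, hF0, blaschkeFactor]
  have hb : ‖b‖ < 1 := hg1 z₀ hz₀L
  have hbτ : ‖b‖ = τ := by
    rw [← sq_eq_sq₀ (norm_nonneg _) hτ0.le, ← norm_pow, hb2, norm_neg, hna]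
  have hb0 : b ≠ 0 := Complex.exp_ne_zero _
  have hτ1 : τ < 1 := hbτ ▸ hb
  set k : ℂ → ℂ := fun z => blaschkeFactor b (g z)
  have hk : PolyApprox L k := hg.comp hL hgball (differentiableOn_blaschkeFactor hb)
  have hfd : HasDerivAt f 1 z₀ := by
    rw [← h1]
    exact (hf.differentiableOn_interior.differentiableAt
      (isOpen_interior.mem_nhds (hKK' hz₀))).hasDerivAt
  have hFd : HasDerivAt F (ρ : ℂ)⁻¹ z₀ := by simpa using hfd.const_mul (ρ : ℂ)⁻¹
  have hhd : HasDerivAt h ((1 - ‖a‖ ^ 2 : ℝ) * (ρ : ℂ)⁻¹) z₀ := by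
    have h2 := hasDerivAt_blaschkeFactor ha (z := F z₀) (hF1 z₀ hz₀L)
    exact (h2.comp z₀ hFd).congr_deriv (by simp [hF0])
  have hgd : HasDerivAt g (deriv g z₀) z₀ := (hg.differentiableOn_interior.differentiableAt
    (isOpen_interior.mem_nhds (hKL hz₀))).hasDerivAt
  have hgd2 : 2 * b * deriv g z₀ = (1 - ‖a‖ ^ 2 : ℝ) * (ρ : ℂ)⁻¹ := by
    have h2 : HasDerivAt h (2 * b * deriv g z₀) z₀ := by
      refine HasDerivAt.congr_of_eventuallyEq (f := fun z => g z ^ 2) ?_ ?_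
      · exact (hgd.fun_pow 2).congr_deriv (by simp [b])
      · filter_upwards [hLn] with z hz using (hg2 z hz).symm
    exact h2.unique hhd
  set d : ℂ := (1 - ‖b‖ ^ 2 : ℝ) / (1 - conj b * b) ^ 2 * deriv g z₀
  have hkd : HasDerivAt k d z₀ := by
    have h2 := hasDerivAt_blaschkeFactor hb (z := g z₀) hb
    exact h2.comp z₀ hgd
  have hnd : ‖d‖ = (1 + τ ^ 2) / (2 * τ * ρ) := by
    have h2 : ‖deriv g z₀‖ = (1 - τ ^ 4) / (2 * τ * ρ) := by
      have h3 := congrArg norm hgd2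
      rw [norm_mul, norm_mul, norm_mul, norm_inv, Complex.norm_real, Complex.norm_real,
        Real.norm_of_nonneg hρ0.le, hbτ, Complex.norm_ofNat, hna,
        Real.norm_of_nonneg (by nlinarith [pow_le_one₀ hτ0.le hτ1.le (n := 4)])] at h3
      rw [eq_div_iff (by positivity)]
      field_simp at h3
      linarith
    have h4 : (1 - conj b * b : ℂ) = (1 - τ ^ 2 : ℝ) := by
      rw [Complex.conj_mul', hbτ]; push_cast; ring
    have h5 : 0 < 1 - τ ^ 2 := by nlinarith
    simp only [d]
    rw [norm_mul, norm_div, norm_pow, h4, hbτ, Complex.norm_real, Real.norm_of_nonneg h5.le, h2]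
    field_simp
    ring
  have hd0 : d ≠ 0 := by
    rw [← norm_ne_zero_iff, hnd]
    positivity
  refine ⟨L, fun z => d⁻¹ * k z, hL, hKL, hk.const_mul hL _, ?_, ?_, ?_, ?_⟩
  · intro z hz y hy hzy
    have h2 : k z = k y := mul_left_cancel₀ (inv_ne_zero hd0) hzy
    have h3 : g z = g y := injOn_blaschkeFactor hb (hgball hz) (hgball hy) h2
    have h4 : h z = h y := by rw [← hg2 z hz, ← hg2 y hy, h3]
    have h5 : F z = F y := injOn_blaschkeFactor ha (hFball hz) (hFball hy) h4
    exact hinj (hLK' hz) (hLK' hy) (mul_left_cancel₀ (inv_ne_zero hρc) h5)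
  · simp [k, blaschkeFactor, b]
  · rw [(hkd.const_mul d⁻¹).deriv, inv_mul_cancel₀ hd0]
  · intro z hz
    have h2 : ‖k z‖ < 1 := norm_blaschkeFactor_lt_one hb (hg1 z hz)
    rw [norm_mul, norm_inv, hnd, inv_div]
    calc 2 * τ * ρ / (1 + τ ^ 2) * ‖k z‖ < 2 * τ * ρ / (1 + τ ^ 2) * 1 := by gcongr
      _ = ρ * (2 * τ / (1 + τ ^ 2)) := by ring

/-- Above the inner conformal radius every bound is attained by an approximable map. -/
theorem hasNormalizedMap_of_lt {G K : Set ℂ} {z₀ : ℂ} (hK : IsCompact K)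
    (hKc : IsPreconnected Kᶜ) (hz₀ : z₀ ∈ G) (hGK : G ⊆ K)
    (hKG : ∀ O, IsOpen O → IsPreconnected O → O ⊆ K → (O ∩ G).Nonempty → O ⊆ G)
    {R : ℝ} (hR : 0 < R) {φ : ℂ → ℂ} (hφd : DifferentiableOn ℂ φ G) (hG : IsOpen G)
    (hφ : MapsTo φ G (ball 0 R)) (hφ0 : φ z₀ = 0) (hφ1 : deriv φ z₀ = 1) {ρ : ℝ} (hρ : R < ρ) :
    HasNormalizedMap K z₀ ρ := by
  set S : Set ℝ := {ρ | HasNormalizedMap K z₀ ρ}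
  have hz₀K := hGK hz₀
  have hpos : ∀ r ∈ S, 0 < r := by
    rintro r ⟨K', f, -, hKK', -, -, -, -, h⟩
    exact (norm_nonneg _).trans_lt (h z₀ (interior_subset (hKK' hz₀K)))
  have hbdd : BddBelow S := ⟨0, fun r hr => (hpos r hr).le⟩
  have hSne : S.Nonempty := hasNormalizedMap_of_isCompact hK z₀
  rcases lt_or_ge (sInf S) ρ with hlt | hge
  · obtain ⟨r, hr, hrρ⟩ := exists_lt_of_csInf_lt hSne hlt
    exact hr.mono hrρ.le
  exfalso
  set M := sInf S
  obtain ⟨s, hRs, hsM⟩ := exists_between (hρ.trans_le hge)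
  have hs0 : 0 < s := hR.trans hRs
  have hM0 : 0 < M := hs0.trans hsM
  set τ₀ := Real.sqrt (s / M)
  have hτ₀ : 0 < τ₀ := Real.sqrt_pos.2 (by positivity)
  have hτ₀1 : τ₀ < 1 := by
    rw [Real.sqrt_lt' one_pos, one_pow, div_lt_one hM0]
    exact hsM
  set c := 2 * τ₀ / (1 + τ₀ ^ 2)
  have hc0 : 0 < c := by positivity
  have hc1 : c < 1 := by
    rw [div_lt_one (by positivity)]
    nlinarith [sq_pos_of_pos (sub_pos.2 hτ₀1)]
  have hMc : M < M / c := by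
    rw [lt_div_iff₀ hc0]
    nlinarith
  obtain ⟨r, hr, hrM⟩ := exists_lt_of_csInf_lt hSne hMc
  have hMr : M ≤ r := csInf_le hbdd hr
  obtain ⟨K', f, hK', hKK', hf, hinj, hf0, hf1, hfr⟩ := hr
  have hnot : ¬ ball 0 s ⊆ f '' K := fun hsub => hRs.not_ge
    (le_of_ball_subset_image hz₀ hGK hKG hφd hG hφ hφ0 hφ1 isOpen_interior hKK'
      hf.differentiableOn_interior (hinj.mono interior_subset) hf0 hf1 hs0 hsub)
  obtain ⟨w, hw, hwK⟩ := not_subset.1 hnot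
  rw [mem_ball_zero_iff] at hw
  have hw0 : 0 < ‖w‖ := norm_pos_iff.2 fun h => hwK ⟨z₀, hz₀K, hf0.trans h.symm⟩
  have hr0 : 0 < r := hM0.trans_le hMr
  set τ := Real.sqrt (‖w‖ / r)
  have hτ : 0 < τ := Real.sqrt_pos.2 (by positivity)
  have hττ₀ : τ ≤ τ₀ := Real.sqrt_le_sqrt (by gcongr)
  have hstep := koebe_step hK hKc hz₀K hKK' hf hinj hf0 hf1 hfr (hw.trans (hsM.trans_le hMr)) hwK
    hτ (Real.sq_sqrt (by positivity))
  have hle : 2 * τ / (1 + τ ^ 2) ≤ c := by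
    rw [div_le_div_iff₀ (by positivity) (by positivity)]
    nlinarith [mul_nonneg (sub_nonneg.2 hττ₀) (sub_nonneg.2 (mul_le_one₀ hτ₀1.le hτ.le
      (hττ₀.trans hτ₀1.le)))]
  have h2 : M ≤ r * c := csInf_le hbdd (hstep.mono (by gcongr))
  rw [lt_div_iff₀ hc0] at hrM
  exact hrM.not_ge h2

/-- An injective holomorphic image inside a disk of radius `ρ` has area at most `π ρ ^ 2`. -/
theorem setIntegral_norm_deriv_sq_le {G : Set ℂ} (hG : IsOpen G) {f : ℂ → ℂ}
    (hf : DifferentiableOn ℂ f G) (hinj : InjOn f G) {ρ : ℝ} (hρ : 0 ≤ ρ)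
    (hmaps : MapsTo f G (ball 0 ρ)) : ∫ z in G, ‖deriv f z‖ ^ 2 ≤ Real.pi * ρ ^ 2 := by
  have h1 := setIntegral_image_of_holomorphic hG hf hinj fun _ => 1
  simp only [mul_one] at h1
  rw [← h1, setIntegral_const, smul_eq_mul, mul_one]
  calc volume.real (f '' G) ≤ volume.real (ball (0 : ℂ) ρ) :=
        measureReal_mono (image_subset_iff.2 hmaps) measure_ball_lt_top.ne
    _ = Real.pi * ρ ^ 2 := by
        rw [measureReal_def, Complex.volume_ball, ENNReal.toReal_mul, ENNReal.toReal_pow,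
          ENNReal.toReal_ofReal hρ]
        simp [mul_comm]

theorem HasNormalizedMap.one_le {G K : Set ℂ} (hG : IsOpen G) (hGb : Bornology.IsBounded G)
    (hGK : closure G ⊆ K) {z₀ : ℂ} (hz₀ : z₀ ∈ G) {P : ℕ → ℂ[X]} (hP : AreaOrthonormalPolys G P)
    {ρ : ℝ} (hρ : HasNormalizedMap K z₀ ρ) {T : ℝ}
    (hT : ∀ s : Finset ℕ, ∑ k ∈ s, ‖(P k).eval z₀‖ ^ 2 ≤ T) : 1 ≤ Real.pi * ρ ^ 2 * T := by
  obtain ⟨K', f, hK', hKK', hf, hinj, hf0, hf1, hfρ⟩ := hρ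
  have hGint : closure G ⊆ interior K' := hGK.trans hKK'
  have hGK' : G ⊆ K' := (subset_closure.trans hGint).trans interior_subset
  have hρ0 : 0 < ρ := (norm_nonneg _).trans_lt (hfρ z₀ (hGK' hz₀))
  have hGc : IsCompact (closure G) := hGb.isCompact_closure
  have hF : PolyApprox (closure G) (deriv f) := hf.deriv hGc hGint
  have hint : ∫ z in G, ‖deriv f z‖ ^ 2 ≤ Real.pi * ρ ^ 2 :=
    setIntegral_norm_deriv_sq_le hG
      (hf.differentiableOn_interior.mono (subset_closure.trans hGint)) (hinj.mono hGK') hρ0.le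
      fun z hz => mem_ball_zero_iff.2 (hfρ z (hGK' hz))
  have hFi : IntegrableOn (fun z => ‖deriv f z‖ ^ 2) G :=
    ((hF.continuousOn.norm.pow 2).integrableOn_compact hGc).mono_set subset_closure
  obtain ⟨B, hB⟩ := hGc.exists_bound_of_continuousOn hF.continuousOn
  have hT0 : 0 ≤ T := by simpa using hT ∅
  have hvol : volume G ≠ ⊤ := hGb.measure_lt_top.ne
  have key : ∀ δ ∈ Ioc (0 : ℝ) 1,
      (1 - δ) ^ 2 ≤ (Real.pi * ρ ^ 2 + volume.real G * (δ * (2 * B + 1))) * T := by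
    rintro δ ⟨hδ0, hδ1⟩
    obtain ⟨q, hq⟩ := hF δ hδ0
    have hq0 : 1 - δ ≤ ‖q.eval z₀‖ := by
      have h1 := hq z₀ (subset_closure hz₀)
      rw [hf1] at h1
      have h2 := norm_sub_norm_le 1 (q.eval z₀)
      rw [norm_one] at h2
      linarith
    have hq2 : ∫ z in G, ‖q.eval z‖ ^ 2 ≤ Real.pi * ρ ^ 2 + volume.real G * (δ * (2 * B + 1)) := by
      calc ∫ z in G, ‖q.eval z‖ ^ 2 ≤ ∫ z in G, (‖deriv f z‖ ^ 2 + δ * (2 * B + 1)) := by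
            refine setIntegral_mono_on
              (integrableOn_of_continuous_of_isBounded hGb (q.continuous.norm.pow 2))
              (hFi.add (integrableOn_const hvol)) hG.measurableSet fun z hz => ?_
            have h1 := hq z (subset_closure hz)
            have h2 := hB z (subset_closure hz)
            have h3 : ‖q.eval z‖ ≤ ‖deriv f z‖ + δ := by
              have := norm_sub_norm_le (q.eval z) (deriv f z)
              rw [norm_sub_rev] at this
              linarith
            calc ‖q.eval z‖ ^ 2 ≤ (‖deriv f z‖ + δ) ^ 2 := by gcongr
              _ ≤ _ := by nlinarith [norm_nonneg (deriv f z)]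
        _ = (∫ z in G, ‖deriv f z‖ ^ 2) + volume.real G * (δ * (2 * B + 1)) := by
            rw [integral_add hFi (integrableOn_const hvol), setIntegral_const, smul_eq_mul]
        _ ≤ _ := by gcongr
    obtain ⟨s, hs⟩ := hP.exists_one_le_mul_sum hGb q z₀
    have hq2' : 0 ≤ ∫ z in G, ‖q.eval z‖ ^ 2 := integral_nonneg fun z => by positivity
    calc (1 - δ) ^ 2 ≤ ‖q.eval z₀‖ ^ 2 := by
          have : 0 ≤ 1 - δ := by linarith
          gcongr
      _ ≤ _ := hs
      _ ≤ (∫ z in G, ‖q.eval z‖ ^ 2) * T := by gcongr; exact hT s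
      _ ≤ _ := by gcongr
  have h1 : Tendsto (fun δ : ℝ => (1 - δ) ^ 2) (𝓝[>] 0) (𝓝 1) := by
    refine tendsto_nhdsWithin_of_tendsto_nhds (Continuous.tendsto' (by fun_prop) _ _ (by simp))
  have h2 : Tendsto (fun δ : ℝ => (Real.pi * ρ ^ 2 + volume.real G * (δ * (2 * B + 1))) * T)
      (𝓝[>] 0) (𝓝 (Real.pi * ρ ^ 2 * T)) :=
    tendsto_nhdsWithin_of_tendsto_nhds (Continuous.tendsto' (by fun_prop) _ _ (by simp))
  exact le_of_tendsto_of_tendsto h1 h2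
    (Filter.mem_of_superset (Ioc_mem_nhdsGT one_pos) key)

end

/-- `Σ_{k=0}^∞ |K_k(z₀)|² = 1 / (π R₀²)`, where `R₀` is the inner conformal
radius of the Jordan domain `G` with respect to `z₀`. -/
theorem tsum_sq_orthonormal_polys_eq_inv_pi_radius_sq
    (G : Set ℂ) (hG : IsJordanDomain G) (z₀ : ℂ) (hz₀ : z₀ ∈ G)
    (K : ℕ → Polynomial ℂ) (hK : AreaOrthonormalPolys G K)
    (R₀ : ℝ) (hR₀ : 0 < R₀) (φ : ℂ → ℂ)
    (hφdiff : DifferentiableOn ℂ φ G)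
    (hφbij : Set.BijOn φ G (Metric.ball (0 : ℂ) R₀))
    (hφ0 : φ z₀ = 0) (hφ1 : deriv φ z₀ = 1) :
    HasSum (fun k : ℕ => ‖(K k).eval z₀‖ ^ 2) (1 / (Real.pi * R₀ ^ 2)) := by
  obtain ⟨L, hL, hLc, hGL, habs⟩ := hG.exists_hull
  have hGo : IsOpen G := hG.1
  have hGb : Bornology.IsBounded G := hG.2.1
  refine hasSum_of_isLUB_of_nonneg _ (fun k => by positivity) ⟨?_, fun T hT => ?_⟩
  · rintro _ ⟨s, rfl⟩
    exact hK.sum_norm_sq_le hGo hGb hz₀ hR₀ hφdiff hφbij hφ0 hφ1 s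
  · rw [div_le_iff₀ (by positivity), mul_comm]
    have hlim : Filter.Tendsto (fun ρ : ℝ => Real.pi * ρ ^ 2 * T) (nhdsWithin R₀ (Set.Ioi R₀))
        (nhds (Real.pi * R₀ ^ 2 * T)) :=
      tendsto_nhdsWithin_of_tendsto_nhds (Continuous.tendsto' (by fun_prop) _ _ rfl)
    refine ge_of_tendsto hlim ?_
    filter_upwards [self_mem_nhdsWithin] with ρ hρ
    exact (hasNormalizedMap_of_lt hL hLc hz₀ (subset_closure.trans hGL) habs hR₀ hφdiff hGo
      hφbij.mapsTo hφ0 hφ1 hρ).one_le hGo hGb hGL hz₀ hK fun s => hT ⟨s, rfl⟩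
end
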